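/- Let 0 < k ≤ l, let Y be a random variable with the Gamma(k) distribution, and let X be a positive random variable whose density is hyperbolically monotone of order l (HM_l), with Y and X independent. Then the distribution of the product Y·X is a generalized gamma convolution (GGC). -/

import Mathlib

open MeasureTheory ProbabilityTheory Real

noncomputable section

/-- A probability measure on `[0,∞)` is a generalized gamma convolution (GGC) if its
Laplace transform has the Thorin form. -/
def IsGGC (μ : Measure ℝ) : Prop :=
  IsProbabilityMeasure μ ∧ μ (Set.Iio 0) = 0 ∧
  ∃ (a : ℝ) (U : Measure ℝ),
    0 ≤ a ∧ U (Set.Iic 0) = 0 ∧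
    (∀ r s : ℝ, 0 < r → U (Set.Icc r s) < ⊤) ∧
    (∫⁻ t in Set.Ioc (0:ℝ) 1, ENNReal.ofReal |Real.log t| ∂U) < ⊤ ∧
    (∫⁻ t in Set.Ici (1:ℝ), ENNReal.ofReal t⁻¹ ∂U) < ⊤ ∧
    ∀ s : ℝ, 0 ≤ s →
      (∫ x, Real.exp (-s * x) ∂μ) =
        Real.exp (-(a * s) + ∫ t in Set.Ioi (0:ℝ), Real.log (t / (t + s)) ∂U)

/-- A probability density `f` on `(0,∞)` is hyperbolically monotone of order `k` (`HM_k`). -/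
def IsHMDensity (k : ℝ) (f : ℝ → ℝ) : Prop :=
  (∀ x, 0 ≤ f x) ∧ (∫⁻ x in Set.Ioi (0:ℝ), ENNReal.ofReal (f x)) = 1 ∧
  ∀ u : ℝ, 0 < u → ∃ H : Measure ℝ,
    ∀ v : ℝ, 0 < v →
      ENNReal.ofReal (f (u * v) * f (u / v)) =
        ∫⁻ lam in Set.Ioi (v + v⁻¹), ENNReal.ofReal ((lam - (v + v⁻¹)) ^ (k - 1)) ∂H

/-- The random variable `X` has density `f` (with respect to Lebesgue measure) on `(0,∞)`. -/
def HasDensityOn {Ω : Type*} [MeasurableSpace Ω] (P : Measure Ω) (X : Ω → ℝ)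
    (f : ℝ → ℝ) : Prop :=
  Measure.map X P =
    (volume.restrict (Set.Ioi (0:ℝ))).withDensity (fun x => ENNReal.ofReal (f x))

/-- The `Gamma(k, r)` distribution, with density `r^k Γ(k)⁻¹ x^(k-1) e^(-r x)` on `(0,∞)`. -/
def gammaMeas (k r : ℝ) : Measure ℝ :=
  (volume.restrict (Set.Ioi (0:ℝ))).withDensity
    (fun x => ENNReal.ofReal (r ^ k / Real.Gamma k * x ^ (k - 1) * Real.exp (-(r * x))))

/-- `g` is completely monotone on `(0,∞)`:  infinitely differentiable with
`(-1)^n g^(n)(T) ≥ 0` for all `T > 0` and `n ≥ 0`. -/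
def CompletelyMonotoneOn (g : ℝ → ℝ) : Prop :=
  ContDiffOn ℝ (⊤ : ℕ∞) g (Set.Ioi 0) ∧
  ∀ (n : ℕ) (T : ℝ), 0 < T →
    0 ≤ (-1 : ℝ) ^ n * iteratedDerivWithin n g (Set.Ioi 0) T

end

lemma re_sub_re_eq_circleAverage {p : ℂ → ℂ} (hp : DifferentiableOn ℂ p (Metric.ball 0 1))
    {r ζ : ℝ} (hr1 : r < 1) (hζ : |ζ| < r) :
    (p ζ).re - (p 0).re =
      Real.circleAverage (fun z => 2 * ζ * (z.im * (p z).im / ‖z - ζ‖ ^ 2)) 0 r := by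
  have hr : 0 < r := (abs_nonneg ζ).trans_lt hζ
  have hsub : Metric.closedBall (0 : ℂ) r ⊆ Metric.ball 0 1 :=
    Metric.closedBall_subset_ball hr1
  have hd : DiffContOnCl ℂ p (Metric.ball 0 |r|) := by
    rw [abs_of_pos hr]
    apply DifferentiableOn.diffContOnCl
    rw [closure_ball _ hr.ne']
    exact hp.mono hsub
  have hne : ∀ z ∈ Metric.closedBall (0 : ℂ) r, (r : ℂ) ^ 2 - ζ * z ≠ 0 := by
    intro z hz h
    have h1 : (r : ℂ) ^ 2 = ζ * z := sub_eq_zero.mp h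
    have h2 := congrArg norm h1
    simp only [norm_pow, Complex.norm_real, norm_mul, Real.norm_eq_abs, abs_of_pos hr] at h2
    have h3 : ‖z‖ ≤ r := by simpa using hz
    nlinarith [norm_nonneg z, abs_nonneg ζ]
  have hd2 : DiffContOnCl ℂ (fun z => ((r : ℂ) ^ 2 / ((r : ℂ) ^ 2 - ζ * z)) * p z)
      (Metric.ball 0 |r|) := by
    rw [abs_of_pos hr]
    apply DifferentiableOn.diffContOnCl
    rw [closure_ball _ hr.ne']
    intro z hz
    refine DifferentiableWithinAt.mul ?_ ((hp.mono hsub) z hz)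
    exact DifferentiableWithinAt.div (by fun_prop) (by fun_prop) (hne z hz)
  have e1 := hd.circleAverage_smul_div (w := (ζ : ℂ)) (by simpa [abs_of_pos hr] using hζ)
  have e2 := hd2.circleAverage
  have hcont : ContinuousOn p (Metric.sphere 0 |r|) := by
    rw [abs_of_pos hr]
    exact hp.continuousOn.mono (Metric.sphere_subset_closedBall.trans hsub)
  have hzn : ∀ z ∈ Metric.sphere (0 : ℂ) |r|, z - ζ ≠ 0 := by
    intro z hz h
    rw [sub_eq_zero] at h
    simp [h, abs_of_pos hr] at hz
    linarith
  have i1 : CircleIntegrable (fun z => ((z - 0) / (z - ζ)) • p z) 0 r := by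
    apply ContinuousOn.circleIntegrable'
    exact ContinuousOn.smul (ContinuousOn.div (by fun_prop) (by fun_prop) hzn) hcont
  have i2 : CircleIntegrable (fun z => ((r : ℂ) ^ 2 / ((r : ℂ) ^ 2 - ζ * z)) * p z) 0 r := by
    apply ContinuousOn.circleIntegrable'
    refine ContinuousOn.mul (ContinuousOn.div (by fun_prop) (by fun_prop) fun z hz => hne z ?_) hcont
    rw [abs_of_pos hr] at hz
    exact Metric.sphere_subset_closedBall hz
  have e3 : Real.circleAverage ((fun z : ℂ => ((z - 0) / (z - ζ)) • p z) -
      fun z : ℂ => ((r : ℂ) ^ 2 / ((r : ℂ) ^ 2 - ζ * z)) * p z) 0 r = p ζ - p 0 := by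
    rw [Real.circleAverage_sub i1 i2, e1, e2]
    have : (r : ℂ) ≠ 0 := by exact_mod_cast hr.ne'
    simp [this]
  have i3 : CircleIntegrable ((fun z : ℂ => ((z - 0) / (z - ζ)) • p z) -
      fun z : ℂ => ((r : ℂ) ^ 2 / ((r : ℂ) ^ 2 - ζ * z)) * p z) 0 r := by
    have := IntervalIntegrable.sub i1 i2
    exact this
  have e4 := Complex.reCLM.circleAverage_comp_comm i3
  rw [e3] at e4
  rw [← Complex.sub_re]
  simp only [Complex.reCLM_apply] at e4
  rw [← e4]
  apply Real.circleAverage_congr_sphere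
  intro z hz
  have hz' := hzn z hz
  have hzr : z * (starRingEnd ℂ) z = (r : ℂ) ^ 2 := by
    rw [Complex.mul_conj']
    simp at hz
    rw [hz, abs_of_pos hr]
  have hz0 : z ≠ 0 := by
    rintro rfl
    simp at hz
    exact hr.ne' (abs_eq_zero.mp hz.symm)
  have hcz : (starRingEnd ℂ) z - ζ ≠ 0 := by
    intro h
    apply hz'
    have := congrArg (starRingEnd ℂ) h
    simpa using this
  have k1 : (r : ℂ) ^ 2 / ((r : ℂ) ^ 2 - ζ * z) =
      (starRingEnd ℂ) z / ((starRingEnd ℂ) z - ζ) := by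
    rw [← hzr]
    rw [show z * (starRingEnd ℂ) z - ζ * z = z * ((starRingEnd ℂ) z - ζ) by ring]
    exact mul_div_mul_left _ _ hz0
  have k2 : z / (z - ζ) - (starRingEnd ℂ) z / ((starRingEnd ℂ) z - ζ) =
      ((-2 * ζ * z.im / ‖z - ζ‖ ^ 2 : ℝ) : ℂ) * Complex.I := by
    have : (‖z - ζ‖ : ℂ) ^ 2 = (z - ζ) * ((starRingEnd ℂ) z - ζ) := by
      rw [← Complex.mul_conj']; simp
    push_cast
    rw [this, div_sub_div _ _ hz' hcz]
    rw [div_mul_eq_mul_div]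
    congr 1
    apply Complex.ext <;> simp <;> ring
  simp only [Function.comp, Pi.sub_apply, sub_zero, smul_eq_mul]
  rw [k1, ← sub_mul, k2]
  rw [mul_assoc, Complex.reCLM_apply, Complex.re_ofReal_mul, Complex.I_mul_re]
  ring

/-- Representation of functions analytic in the unit disc whose imaginary part has the sign of
the imaginary part of the argument. -/
theorem exists_measure_of_im_mul_im_nonneg {p : ℂ → ℂ}
    (hp : DifferentiableOn ℂ p (Metric.ball 0 1))
    (hpos : ∀ z ∈ Metric.ball (0 : ℂ) 1, 0 ≤ z.im * (p z).im) :
    ∃ μ : Measure ℝ, IsFiniteMeasure μ ∧ μ (Set.Icc (-1) 1)ᶜ = 0 ∧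
      ∀ ζ : ℝ, |ζ| < 1 →
        (p ζ).re = (p 0).re + ∫ c, 2 * ζ / (1 - 2 * ζ * c + ζ ^ 2) ∂μ := by
  -- the approximating measures
  have key : ∀ r : ℝ, 1 / 2 < r → r < 1 → ∃ μ : FiniteMeasure ℝ, (μ : Measure ℝ) (Set.Icc (-1) 1)ᶜ = 0 ∧
      ∀ ζ : ℝ, |ζ| < r →
        (p ζ).re - (p 0).re = ∫ c, 2 * ζ / (r ^ 2 - 2 * r * ζ * c + ζ ^ 2) ∂(μ : Measure ℝ) := by
    intro r hr2 hr1
    have hr : 0 < r := by linarith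
    set F : ℝ → ℝ := fun θ => (2 * π)⁻¹ * ((circleMap 0 r θ).im * (p (circleMap 0 r θ)).im) with hF
    have hmem : ∀ θ, circleMap 0 r θ ∈ Metric.ball (0 : ℂ) 1 := by
      intro θ
      simp [abs_of_pos hr, hr1]
    have hFc : Continuous F := by
      have : Continuous fun θ => p (circleMap 0 r θ) :=
        hp.continuousOn.comp_continuous (continuous_circleMap 0 r) hmem
      exact continuous_const.mul ((Complex.continuous_im.comp (continuous_circleMap 0 r)).mul
        (Complex.continuous_im.comp this))
    have hF0 : ∀ θ, 0 ≤ F θ := fun θ => mul_nonneg (by positivity) (hpos _ (hmem θ))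
    let ν : Measure ℝ := (volume.restrict (Set.Ioc 0 (2 * π))).withDensity
      (fun θ => ENNReal.ofReal (F θ))
    have hFi : IntegrableOn F (Set.Ioc 0 (2 * π)) :=
      (hFc.integrableOn_Icc).mono_set Set.Ioc_subset_Icc_self
    have hν : IsFiniteMeasure ν := isFiniteMeasure_withDensity_ofReal hFi.2
    refine ⟨⟨ν.map Real.cos, inferInstance⟩, ?_, ?_⟩
    · simp only [FiniteMeasure.toMeasure_mk]
      rw [Measure.map_apply Real.measurable_cos measurableSet_Icc.compl]
      convert measure_empty (μ := ν)
      ext θ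
      simp [Real.neg_one_le_cos, Real.cos_le_one]
    · intro ζ hζ
      rw [re_sub_re_eq_circleAverage hp hr1 hζ]
      simp only [FiniteMeasure.toMeasure_mk]
      have hden : ∀ c ∈ Set.Icc (-1 : ℝ) 1, r ^ 2 - 2 * r * ζ * c + ζ ^ 2 ≠ 0 := by
        intro c hc
        have := abs_lt.mp hζ
        have h2 : (r - |ζ|) ^ 2 ≤ r ^ 2 - 2 * r * ζ * c + ζ ^ 2 := by
          have : ζ * c ≤ |ζ| := by
            calc ζ * c ≤ |ζ * c| := le_abs_self _
              _ = |ζ| * |c| := abs_mul _ _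
              _ ≤ |ζ| * 1 := by gcongr; exact abs_le.mpr hc
              _ = |ζ| := mul_one _
          nlinarith [sq_abs ζ]
        have h3 : 0 < (r - |ζ|) ^ 2 := by
          have : 0 < r - |ζ| := by linarith
          positivity
        linarith
      rw [integral_map Real.measurable_cos.aemeasurable
        (Measurable.aestronglyMeasurable (by fun_prop))]
      rw [integral_withDensity_eq_integral_toReal_smul (by fun_prop) (by simp)]
      simp only [Real.circleAverage, smul_eq_mul]
      rw [intervalIntegral.integral_of_le (by positivity), ← integral_const_mul]
      congr 1
      ext θ
      rw [ENNReal.toReal_ofReal (hF0 θ)]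
      have : ‖circleMap 0 r θ - ζ‖ ^ 2 = r ^ 2 - 2 * r * ζ * Real.cos θ + ζ ^ 2 := by
        rw [← Complex.normSq_eq_norm_sq, Complex.normSq_apply]
        simp [circleMap, Complex.exp_ofReal_mul_I_re, Complex.exp_ofReal_mul_I_im]
        nlinarith [Real.sin_sq_add_cos_sq θ]
      rw [this, hF]
      ring
  choose! M hM0 hM using key
  set C : NNReal := Real.toNNReal (25 / 8 * ((p ((1/4 : ℝ) : ℂ)).re - (p 0).re)) with hC
  have hcompact := isCompact_setOfPred_finiteMeasure_le_of_isCompact C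
    (isCompact_Icc (a := (-1 : ℝ)) (b := 1))
  have hsupp : ∀ r, 1/2 < r → r < 1 → ∀ᵐ c ∂(M r : Measure ℝ), c ∈ Set.Icc (-1 : ℝ) 1 := by
    intro r h1 h2
    exact hM0 r h1 h2
  have hden : ∀ {r ζ c : ℝ}, |ζ| < r → c ∈ Set.Icc (-1 : ℝ) 1 →
      (r - |ζ|) ^ 2 ≤ r ^ 2 - 2 * r * ζ * c + ζ ^ 2 ∧
      r ^ 2 - 2 * r * ζ * c + ζ ^ 2 ≤ (r + |ζ|) ^ 2 := by
    intro r ζ c hζ hc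
    have hr : 0 < r := (abs_nonneg ζ).trans_lt hζ
    have : |ζ * c| ≤ |ζ| := by
      calc |ζ * c| = |ζ| * |c| := abs_mul _ _
        _ ≤ |ζ| * 1 := by gcongr; exact abs_le.mpr hc
        _ = |ζ| := mul_one _
    have := abs_le.mp this
    constructor <;> nlinarith [sq_abs ζ]
  have hmass : ∀ r, 1/2 < r → r < 1 → (M r).mass ≤ C := by
    intro r h1 h2
    have hz : |(1/4 : ℝ)| < r := by rw [abs_of_pos (by norm_num)]; linarith
    have h := hM r h1 h2 (1/4) hz
    have hle : ∫ c, (8/25 : ℝ) ∂(M r : Measure ℝ) ≤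
        ∫ c, 2 * (1/4) / (r ^ 2 - 2 * r * (1/4) * c + (1/4) ^ 2) ∂(M r : Measure ℝ) := by
      apply integral_mono_ae (integrable_const _)
      · refine Integrable.of_bound (C := 1 / 2 / (r - 1/4) ^ 2)
          (Measurable.aestronglyMeasurable (by fun_prop)) ?_
        filter_upwards [hsupp r h1 h2] with c hc
        have := (hden hz hc).1
        rw [abs_of_pos (by norm_num : (0:ℝ) < 1/4)] at this
        have h0 : 0 < (r - 1/4) ^ 2 := by have : 0 < r - 1/4 := by linarith
                                          positivity
        rw [Real.norm_eq_abs, abs_of_nonneg (div_nonneg (by norm_num) (by linarith))]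
        rw [show (2 * (1/4) : ℝ) = 1/2 by norm_num]
        gcongr
      · filter_upwards [hsupp r h1 h2] with c hc
        have h3 := (hden hz hc)
        rw [abs_of_pos (by norm_num : (0:ℝ) < 1/4)] at h3
        have h0 : 0 < (r - 1/4) ^ 2 := by have : 0 < r - 1/4 := by linarith
                                          positivity
        rw [le_div_iff₀ (by linarith [h3.1])]
        have : (r + 1/4) ^ 2 ≤ (5/4) ^ 2 := by gcongr; linarith
        linarith [h3.2]
    rw [← h] at hle
    simp at hle
    rw [hC, ← NNReal.coe_le_coe]
    refine le_trans ?_ (Real.le_coe_toNNReal _)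
    have e : ((1/4 : ℝ) : ℂ) = 4⁻¹ := by push_cast; norm_num
    rw [e]
    linarith
  set G : Ultrafilter ℝ := Ultrafilter.of (nhdsWithin (1:ℝ) (Set.Iio 1)) with hGdef
  have hG : (G : Filter ℝ) ≤ nhdsWithin (1:ℝ) (Set.Iio 1) := Ultrafilter.of_le _
  have hev : ∀ a < (1:ℝ), ∀ᶠ r in (G : Filter ℝ), a < r ∧ r < 1 := by
    intro a ha
    apply hG
    exact Ioo_mem_nhdsLT ha
  have hG1 : Filter.Tendsto (fun r : ℝ => r) (G : Filter ℝ) (nhds 1) :=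
    hG.trans nhdsWithin_le_nhds
  obtain ⟨μ, hμ, hlim⟩ := hcompact.ultrafilter_le_nhds (G.map M) (by
    rw [Filter.le_principal_iff]
    show ∀ᶠ r in (G : Filter ℝ), _
    filter_upwards [hev (1/2) (by norm_num)] with r hr
    refine ⟨hmass r hr.1 hr.2, ?_⟩
    have := hM0 r hr.1 hr.2
    rw [← FiniteMeasure.ennreal_coeFn_eq_coeFn_toMeasure] at this
    exact_mod_cast this)
  have hlim' : Filter.Tendsto M (G : Filter ℝ) (nhds μ) := hlim
  have hμ0 : (μ : Measure ℝ) (Set.Icc (-1) 1)ᶜ = 0 := by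
    rw [← FiniteMeasure.ennreal_coeFn_eq_coeFn_toMeasure]
    exact_mod_cast hμ.2
  have hμs : ∀ᵐ c ∂(μ : Measure ℝ), c ∈ Set.Icc (-1 : ℝ) 1 := hμ0
  refine ⟨μ, inferInstance, hμ0, ?_⟩
  intro ζ hζ
  -- the limiting kernel, clamped to a bounded continuous function
  let clamp : ℝ → ℝ := fun c => max (-1) (min c 1)
  have hclamp : ∀ c, clamp c ∈ Set.Icc (-1 : ℝ) 1 := fun c =>
    ⟨le_max_left _ _, max_le (by norm_num) (min_le_right _ _)⟩
  have hclamp' : ∀ c ∈ Set.Icc (-1 : ℝ) 1, clamp c = c := by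
    intro c hc
    simp [clamp, hc.1, hc.2]
  have hden1 : ∀ {c : ℝ}, c ∈ Set.Icc (-1 : ℝ) 1 →
      (1 - |ζ|) ^ 2 ≤ 1 - 2 * ζ * c + ζ ^ 2 := by
    intro c hc
    have := (hden hζ hc).1
    linarith
  have hpos1 : 0 < (1 - |ζ|) ^ 2 := by
    have : 0 < 1 - |ζ| := by linarith
    positivity
  let κ : BoundedContinuousFunction ℝ ℝ :=
    BoundedContinuousFunction.ofNormedAddCommGroup
      (fun c => 2 * ζ / (1 - 2 * ζ * clamp c + ζ ^ 2))
      (by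
        refine Continuous.div (by fun_prop) (by fun_prop) fun c => ?_
        have := hden1 (hclamp c)
        linarith)
      (2 * |ζ| / (1 - |ζ|) ^ 2)
      (by
        intro c
        have := hden1 (hclamp c)
        rw [norm_div, Real.norm_eq_abs, Real.norm_eq_abs, abs_mul, abs_two,
          abs_of_pos (by linarith : 0 < 1 - 2 * ζ * clamp c + ζ ^ 2)]
        gcongr)
  have hκ : ∀ c ∈ Set.Icc (-1 : ℝ) 1, κ c = 2 * ζ / (1 - 2 * ζ * c + ζ ^ 2) := by
    intro c hc
    show 2 * ζ / (1 - 2 * ζ * clamp c + ζ ^ 2) = _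
    rw [hclamp' c hc]
  have t1 := (FiniteMeasure.tendsto_iff_forall_integral_tendsto.mp hlim') κ
  have hμκ : ∫ c, κ c ∂(μ : Measure ℝ) = ∫ c, 2 * ζ / (1 - 2 * ζ * c + ζ ^ 2) ∂(μ : Measure ℝ) :=
    integral_congr_ae (hμs.mono fun c hc => hκ c hc)
  rw [hμκ] at t1
  set δ : ℝ := (1 - |ζ|) / 2 with hδ
  have hδ0 : 0 < δ := by rw [hδ]; linarith
  have t2 : Filter.Tendsto (fun r => ∫ c, κ c ∂(M r : Measure ℝ)) (G : Filter ℝ)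
      (nhds ((p ζ).re - (p 0).re)) := by
    rw [tendsto_iff_norm_sub_tendsto_zero]
    refine squeeze_zero' (Filter.Eventually.of_forall fun _ => norm_nonneg _)
      (g := fun r => (1 - r) * (8 * |ζ| / (δ ^ 2 * (1 - |ζ|) ^ 2) * C)) ?_ ?_
    · filter_upwards [hev (1/2) (by norm_num), hev (|ζ| + δ) (by rw [hδ]; linarith)] with r h1 h2
      have hζr : |ζ| < r := by linarith [h2.1]
      have hr0 : 0 < r := by linarith [h1.1]
      have hrd : δ ^ 2 ≤ (r - |ζ|) ^ 2 := by
        have : δ ≤ r - |ζ| := by linarith [h2.1]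
        gcongr
      rw [hM r h1.1 h1.2 ζ hζr, ← integral_sub (κ.integrable _)]
      · have hb : ∀ᵐ c ∂(M r : Measure ℝ),
            ‖κ c - 2 * ζ / (r ^ 2 - 2 * r * ζ * c + ζ ^ 2)‖ ≤
              (1 - r) * (8 * |ζ| / (δ ^ 2 * (1 - |ζ|) ^ 2)) := by
          filter_upwards [hsupp r h1.1 h1.2] with c hc
          rw [hκ c hc]
          have a1 := hden1 hc
          have a2 := (hden hζr hc).1
          have d1 : 0 < 1 - 2 * ζ * c + ζ ^ 2 := by linarith
          have d2 : 0 < r ^ 2 - 2 * r * ζ * c + ζ ^ 2 := by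
            have : 0 < δ ^ 2 := by positivity
            linarith
          rw [div_sub_div _ _ d1.ne' d2.ne', norm_div, Real.norm_eq_abs, Real.norm_eq_abs,
            abs_of_pos (mul_pos d1 d2), ← mul_div_assoc]
          have e : 2 * ζ * (r ^ 2 - 2 * r * ζ * c + ζ ^ 2) - (1 - 2 * ζ * c + ζ ^ 2) * (2 * ζ) =
              (1 - r) * (2 * ζ * (2 * ζ * c - (1 + r))) := by ring
          rw [e, abs_mul, abs_of_pos (by linarith [h1.2] : 0 < 1 - r)]
          have hn : |2 * ζ * (2 * ζ * c - (1 + r))| ≤ 8 * |ζ| := by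
            have b1 : |2 * ζ * c - (1 + r)| ≤ 4 := by
              have : |ζ * c| ≤ 1 := by
                rw [abs_mul]
                calc |ζ| * |c| ≤ 1 * 1 := by
                      gcongr
                      exact abs_le.mpr hc
                  _ = 1 := one_mul 1
              have := abs_le.mp this
              rw [abs_le]
              constructor <;> linarith [h1.1, h1.2]
            rw [abs_mul, abs_mul, abs_two]
            nlinarith [abs_nonneg ζ]
          have hr1 : 0 ≤ 1 - r := by linarith [h1.2]
          apply div_le_div₀ (by positivity) (by gcongr) (by positivity)
          rw [mul_comm]
          exact mul_le_mul a1 (hrd.trans a2) (by positivity) d1.le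
        have := norm_integral_le_of_norm_le_const hb
        refine this.trans ?_
        rw [mul_assoc]
        have hm : (M r : Measure ℝ).real Set.univ ≤ C := by
          have := hmass r h1.1 h1.2
          exact_mod_cast this
        have hr1 : 0 ≤ 1 - r := by linarith [h1.2]
        gcongr
      · refine Integrable.of_bound (C := 2 * |ζ| / δ ^ 2)
          (Measurable.aestronglyMeasurable (by fun_prop)) ?_
        filter_upwards [hsupp r h1.1 h1.2] with c hc
        have a2 := (hden hζr hc).1
        have : 0 < δ ^ 2 := by positivity
        rw [norm_div, Real.norm_eq_abs, Real.norm_eq_abs, abs_mul, abs_two,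
          abs_of_pos (by linarith : 0 < r ^ 2 - 2 * r * ζ * c + ζ ^ 2)]
        gcongr
        linarith
    · have : Filter.Tendsto (fun r : ℝ => (1 - r) * (8 * |ζ| / (δ ^ 2 * (1 - |ζ|) ^ 2) * C))
          (G : Filter ℝ) (nhds ((1 - 1) * (8 * |ζ| / (δ ^ 2 * (1 - |ζ|) ^ 2) * C))) :=
        (tendsto_const_nhds.sub hG1).mul tendsto_const_nhds
      simpa using this
  have := tendsto_nhds_unique t1 t2
  linarith

lemma exists_stieltjes_measure {h : ℝ → ℝ} (hpos : ∀ s, 0 < s → 0 ≤ h s) {μ : Measure ℝ}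
    [IsFiniteMeasure μ] (hμ : μ (Set.Icc (-1) 1)ᶜ = 0)
    (hrep : ∀ s, 0 < s → h s = h 1 - ∫ c, (s - 1) / ((1 + c) + s * (1 - c)) ∂μ) :
    ∃ (a : ℝ) (V : Measure ℝ), 0 ≤ a ∧ SFinite V ∧ V (Set.Iio 0) = 0 ∧
      ∀ s, 0 < s → ENNReal.ofReal (h s) =
        ENNReal.ofReal a + ∫⁻ t, ENNReal.ofReal (1 / (t + s)) ∂V := by
  have hs : ∀ᵐ c ∂μ, c ∈ Set.Icc (-1 : ℝ) 1 := hμ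
  have hden : ∀ {s c : ℝ}, 0 < s → c ∈ Set.Icc (-1 : ℝ) 1 →
      2 * min 1 s ≤ (1 + c) + s * (1 - c) := by
    intro s c hs hc
    have h1 : min 1 s ≤ 1 := min_le_left _ _
    have h2 : min 1 s ≤ s := min_le_right _ _
    nlinarith [hc.1, hc.2]
  have hint : ∀ s, 0 < s → Integrable (fun c => (s - 1) / ((1 + c) + s * (1 - c))) μ := by
    intro s h0
    have hm : 0 < min 1 s := lt_min one_pos h0
    refine Integrable.of_bound (C := |s - 1| / (2 * min 1 s))
      (Measurable.aestronglyMeasurable (by fun_prop)) ?_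
    filter_upwards [hs] with c hc
    have := hden h0 hc
    rw [norm_div, Real.norm_eq_abs, Real.norm_eq_abs,
      abs_of_pos (by linarith : 0 < (1 + c) + s * (1 - c))]
    gcongr
  have hfat : ∫⁻ c, (ENNReal.ofReal (1 - c))⁻¹ ∂μ ≤ ENNReal.ofReal (h 1) := by
    calc ∫⁻ c, (ENNReal.ofReal (1 - c))⁻¹ ∂μ
        ≤ ∫⁻ c, Filter.liminf (fun n : ℕ => ENNReal.ofReal
            ((((n : ℝ) + 1) - 1) / ((1 + c) + ((n : ℝ) + 1) * (1 - c)))) Filter.atTop ∂μ := by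
          apply lintegral_mono_ae
          filter_upwards [hs] with c hc
          apply le_of_eq
          symm
          apply Filter.Tendsto.liminf_eq
          rcases hc.2.lt_or_eq with h1 | h1
          · rw [← ENNReal.ofReal_inv_of_pos (by linarith)]
            apply ENNReal.tendsto_ofReal
            have : Filter.Tendsto (fun n : ℕ => 1 / (2 / (n : ℝ) + (1 - c))) Filter.atTop
                (nhds (1 / (0 + (1 - c)))) := by
              refine Filter.Tendsto.div tendsto_const_nhds ?_ (by linarith)
              exact (tendsto_const_div_atTop_nhds_zero_nat 2).add tendsto_const_nhds
            rw [zero_add, one_div] at this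
            refine this.congr' ?_
            filter_upwards [Filter.eventually_gt_atTop 0] with n hn
            have hn' : (0 : ℝ) < n := by exact_mod_cast hn
            have : (0:ℝ) < 1 - c := by linarith
            have h3 : (0:ℝ) < 1 + c + (n + 1) * (1 - c) := by nlinarith [hc.1]
            have h4 : 2 / (n:ℝ) + (1 - c) = (1 + c + (n + 1) * (1 - c)) / n := by
              field_simp
              ring
            rw [h4, one_div_div, add_sub_cancel_right]
          · subst h1
            simp only [sub_self, ENNReal.ofReal_zero, ENNReal.inv_zero, mul_zero, add_zero,
              add_sub_cancel_right]
            apply ENNReal.tendsto_ofReal_atTop.comp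
            apply Filter.Tendsto.atTop_div_const (by norm_num)
            exact tendsto_natCast_atTop_atTop
      _ ≤ Filter.liminf (fun n : ℕ => ∫⁻ c, ENNReal.ofReal
            ((((n : ℝ) + 1) - 1) / ((1 + c) + ((n : ℝ) + 1) * (1 - c))) ∂μ) Filter.atTop := by
          apply lintegral_liminf_le
          intro n
          fun_prop
      _ ≤ ENNReal.ofReal (h 1) := by
          refine Filter.liminf_le_of_le (by isBoundedDefault) ?_
          intro b hb
          obtain ⟨n, hn⟩ := hb.exists
          refine hn.trans ?_
          have hn1 : (0:ℝ) < (n:ℝ) + 1 := by positivity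
          rw [← ofReal_integral_eq_lintegral_ofReal (hint _ hn1)]
          · apply ENNReal.ofReal_le_ofReal
            have := hrep _ hn1
            have := hpos _ hn1
            linarith
          · filter_upwards [hs] with c hc
            have := hden hn1 hc
            have hm : 0 < min 1 ((n:ℝ)+1) := lt_min one_pos hn1
            apply div_nonneg (by simp) (by linarith)
  have hc1 : ∀ᵐ c ∂μ, c ∈ Set.Ico (-1 : ℝ) 1 := by
    have := ae_lt_top (μ := μ) (f := fun c => (ENNReal.ofReal (1 - c))⁻¹) (by fun_prop)
      (hfat.trans_lt ENNReal.ofReal_lt_top).ne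
    filter_upwards [this, hs] with c h1 h2
    refine ⟨h2.1, ?_⟩
    simpa using h1
  have hfat' : ∫⁻ c, ENNReal.ofReal (1 / (1 - c)) ∂μ ≤ ENNReal.ofReal (h 1) := by
    refine le_trans (le_of_eq ?_) hfat
    apply lintegral_congr_ae
    filter_upwards [hc1] with c hc
    rw [one_div, ENNReal.ofReal_inv_of_pos (by linarith [hc.2])]
  have h0 : 0 ≤ᵐ[μ] fun c => 1 / (1 - c) := by
    filter_upwards [hc1] with c hc
    exact div_nonneg zero_le_one (by linarith [hc.2])
  have hI : Integrable (fun c => 1 / (1 - c)) μ := by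
    refine ⟨Measurable.aestronglyMeasurable (by fun_prop), ?_⟩
    rw [hasFiniteIntegral_iff_ofReal h0]
    exact hfat'.trans_lt ENNReal.ofReal_lt_top
  have ha : ∫ c, 1 / (1 - c) ∂μ ≤ h 1 := by
    rw [← ofReal_integral_eq_lintegral_ofReal hI h0] at hfat'
    exact (ENNReal.ofReal_le_ofReal_iff (hpos 1 one_pos)).mp hfat'
  refine ⟨h 1 - ∫ c, 1 / (1 - c) ∂μ,
    (μ.withDensity fun c => ENNReal.ofReal (2 / (1 - c) ^ 2)).map (fun c => (1 + c) / (1 - c)),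
    by linarith, inferInstance, ?_, ?_⟩
  · rw [Measure.map_apply (by fun_prop) measurableSet_Iio]
    apply withDensity_absolutelyContinuous
    refine measure_mono_null ?_ (show μ (Set.Ico (-1) 1)ᶜ = 0 from hc1)
    intro c hc hc'
    simp only [Set.mem_preimage, Set.mem_Iio] at hc
    have : 0 ≤ (1 + c) / (1 - c) := div_nonneg (by linarith [hc'.1]) (by linarith [hc'.2])
    linarith
  · intro s h0s
    rw [lintegral_map (by fun_prop) (by fun_prop),
      lintegral_withDensity_eq_lintegral_mul _ (by fun_prop) (by fun_prop)]
    have e : ∫⁻ c, ((fun c => ENNReal.ofReal (2 / (1 - c) ^ 2)) *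
        fun c => ENNReal.ofReal (1 / ((1 + c) / (1 - c) + s))) c ∂μ =
        ∫⁻ c, ENNReal.ofReal (1 / (1 - c) - (s - 1) / ((1 + c) + s * (1 - c))) ∂μ := by
      apply lintegral_congr_ae
      filter_upwards [hc1] with c hc
      have h1 : 0 < 1 - c := by linarith [hc.2]
      have h2 : 0 < (1 + c) + s * (1 - c) := by nlinarith [hc.1]
      simp only [Pi.mul_apply]
      rw [← ENNReal.ofReal_mul (by positivity)]
      congr 1
      have h4 : (1 + c) / (1 - c) + s = ((1 + c) + s * (1 - c)) / (1 - c) := by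
        field_simp
      rw [h4, one_div_div, div_mul_div_comm, div_sub_div _ _ h1.ne' h2.ne',
        div_eq_div_iff (by positivity) (by positivity)]
      ring
    have hsub : Integrable (fun c => 1 / (1 - c) - (s - 1) / ((1 + c) + s * (1 - c))) μ :=
      hI.sub (hint s h0s)
    rw [e, ← ofReal_integral_eq_lintegral_ofReal hsub,
      ← ENNReal.ofReal_add (by linarith)]
    · congr 1
      rw [integral_sub hI (hint s h0s), hrep s h0s]
      ring
    · apply integral_nonneg_of_ae
      filter_upwards [hc1] with c hc
      have h1 : 0 < 1 - c := by linarith [hc.2]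
      have h2 : 0 < (1 + c) + s * (1 - c) := by nlinarith [hc.1]
      simp only [Pi.zero_apply, sub_nonneg]
      rw [div_le_div_iff₀ h2 h1]
      nlinarith
    · filter_upwards [hc1] with c hc
      have h1 : 0 < 1 - c := by linarith [hc.2]
      have h2 : 0 < (1 + c) + s * (1 - c) := by nlinarith [hc.1]
      simp only [Pi.zero_apply, sub_nonneg]
      rw [div_le_div_iff₀ h2 h1]
      nlinarith

lemma lintegral_one_div_add {t s : ℝ} (ht : 0 < t) (hs : 0 < s) :
    ∫⁻ σ in Set.Ioc 0 s, ENNReal.ofReal (1 / (t + σ)) = ENNReal.ofReal (log ((t + s) / t)) := by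
  have hd : ∀ x ∈ Set.uIcc 0 s, HasDerivAt (fun σ => log (t + σ)) (1 / (t + x)) x := by
    intro x hx
    rw [Set.uIcc_of_le hs.le] at hx
    exact ((hasDerivAt_id x).const_add t).log (by simp; linarith [hx.1])
  have hc : IntervalIntegrable (fun σ => 1 / (t + σ)) volume 0 s := by
    apply ContinuousOn.intervalIntegrable
    intro x hx
    rw [Set.uIcc_of_le hs.le] at hx
    have : t + x ≠ 0 := by linarith [hx.1]
    exact ContinuousAt.continuousWithinAt (by fun_prop (disch := assumption))
  rw [← ofReal_integral_eq_lintegral_ofReal hc.1, ← intervalIntegral.integral_of_le hs.le,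
    intervalIntegral.integral_eq_sub_of_hasDerivAt hd hc, log_div (by linarith) ht.ne']
  · simp
  · filter_upwards [self_mem_ae_restrict measurableSet_Ioc] with σ hσ
    exact div_nonneg zero_le_one (by linarith [hσ.1])

lemma lintegral_one_div_zero_add {s : ℝ} (hs : 0 < s) :
    ∫⁻ σ in Set.Ioc 0 s, ENNReal.ofReal (1 / (0 + σ)) = ⊤ := by
  by_contra hne
  have h1 : IntervalIntegrable (fun σ : ℝ => σ⁻¹) volume 0 s := by
    rw [intervalIntegrable_iff_integrableOn_Ioc_of_le hs.le]
    refine ⟨Measurable.aestronglyMeasurable (by fun_prop), ?_⟩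
    rw [hasFiniteIntegral_iff_ofReal]
    · simpa [lt_top_iff_ne_top] using hne
    · filter_upwards [self_mem_ae_restrict measurableSet_Ioc] with σ hσ
      exact inv_nonneg.mpr hσ.1.le
  rw [intervalIntegrable_inv_iff] at h1
  rcases h1 with h1 | h1
  · exact hs.ne h1
  · exact h1 (by simp)

lemma exists_thorin_measure {L h : ℝ → ℝ} (hL0 : L 0 = 1) (hLpos : ∀ s, 0 ≤ s → 0 < L s)
    (hcont : ContinuousOn L (Set.Ici 0)) (hderiv : ∀ s, 0 < s → HasDerivAt L (-h s * L s) s)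
    (hpos : ∀ s, 0 < s → 0 ≤ h s) {a : ℝ} (ha : 0 ≤ a) {V : Measure ℝ} [SFinite V]
    (hV0 : V (Set.Iio 0) = 0)
    (hV : ∀ s, 0 < s → ENNReal.ofReal (h s) =
        ENNReal.ofReal a + ∫⁻ t, ENNReal.ofReal (1 / (t + s)) ∂V) :
    ∃ U : Measure ℝ, U (Set.Iic 0) = 0 ∧
      (∀ r s : ℝ, 0 < r → U (Set.Icc r s) < ⊤) ∧
      (∫⁻ t in Set.Ioc (0:ℝ) 1, ENNReal.ofReal |Real.log t| ∂U) < ⊤ ∧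
      (∫⁻ t in Set.Ici (1:ℝ), ENNReal.ofReal t⁻¹ ∂U) < ⊤ ∧
      ∀ s : ℝ, 0 ≤ s →
        L s = Real.exp (-(a * s) + ∫ t in Set.Ioi (0:ℝ), Real.log (t / (t + s)) ∂U) := by
  have hNd : ∀ s, 0 < s → HasDerivAt (fun x => - log (L x)) (h s) s := by
    intro s hs
    have := ((hderiv s hs).log (hLpos s hs.le).ne').neg
    refine this.congr_deriv ?_
    field_simp [(hLpos s hs.le).ne']
  have hNc : ContinuousOn (fun x => - log (L x)) (Set.Ici 0) :=
    (hcont.log fun x hx => (hLpos x hx).ne').neg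
  have hN : ∀ s, 0 < s → ENNReal.ofReal (- log (L s)) =
      ENNReal.ofReal (a * s) + ∫⁻ t, (∫⁻ σ in Set.Ioc 0 s, ENNReal.ofReal (1 / (t + σ))) ∂V := by
    intro s hs
    have hc : ContinuousOn (fun x => - log (L x)) (Set.Icc 0 s) :=
      hNc.mono Set.Icc_subset_Ici_self
    have hi : IntegrableOn h (Set.Ioc 0 s) :=
      intervalIntegral.integrableOn_deriv_of_nonneg hc (fun x hx => hNd x hx.1)
        (fun x hx => hpos x hx.1)
    have := intervalIntegral.integral_eq_sub_of_hasDerivAt_of_le hs.le hc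
      (fun x hx => hNd x hx.1)
      ((intervalIntegrable_iff_integrableOn_Ioc_of_le hs.le).mpr hi)
    rw [hL0, log_one, neg_zero, sub_zero, intervalIntegral.integral_of_le hs.le] at this
    rw [← this, ofReal_integral_eq_lintegral_ofReal hi, lintegral_lintegral_swap
      (Measurable.aemeasurable (by fun_prop))]
    · rw [setLIntegral_congr_fun measurableSet_Ioc (fun x hx => hV x hx.1),
        lintegral_add_left (by fun_prop), lintegral_const, Measure.restrict_apply_univ,
        Real.volume_Ioc, sub_zero, ENNReal.ofReal_mul ha]
    · filter_upwards [self_mem_ae_restrict measurableSet_Ioc] with σ hσ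
      exact hpos σ hσ.1
  have hV00 : V {0} = 0 := by
    have h1 := hN 1 one_pos
    have h2 : V {0} * ⊤ ≤ ENNReal.ofReal (- log (L 1)) := by
      rw [h1]
      refine le_add_of_nonneg_of_le zero_le ?_
      calc V {0} * ⊤ = ∫⁻ t in {0}, (∫⁻ σ in Set.Ioc 0 1, ENNReal.ofReal (1 / (t + σ))) ∂V := by
            rw [lintegral_singleton, lintegral_one_div_zero_add one_pos, mul_comm]
        _ ≤ _ := setLIntegral_le_lintegral _ _
    by_contra hne
    rw [ENNReal.mul_top hne, top_le_iff] at h2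
    exact ENNReal.ofReal_ne_top h2
  have hVIic : V (Set.Iic 0) = 0 := by
    rw [← Set.Iio_union_right]
    exact measure_union_null hV0 hV00
  have hVae : ∀ᵐ t ∂V, 0 < t := by
    rw [ae_iff]
    simpa [not_lt, Set.Iic_def] using hVIic
  have hrV : V.restrict (Set.Ioi 0) = V := Measure.restrict_eq_self_of_ae_mem hVae
  have hN' : ∀ s, 0 < s → ENNReal.ofReal (- log (L s)) =
      ENNReal.ofReal (a * s) + ∫⁻ t, ENNReal.ofReal (log ((t + s) / t)) ∂V := by
    intro s hs
    rw [hN s hs]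
    congr 1
    apply lintegral_congr_ae
    filter_upwards [hVae] with t ht
    exact lintegral_one_div_add ht hs
  have hfin : ∀ s, 0 < s → ∫⁻ t, ENNReal.ofReal (log ((t + s) / t)) ∂V < ⊤ := by
    intro s hs
    refine lt_of_le_of_lt ?_ (ENNReal.ofReal_lt_top (r := - log (L s)))
    rw [hN' s hs]
    exact le_add_self
  have hlog : ∀ t : ℝ, 0 < t → 1 / (t + 1) ≤ log ((t + 1) / t) := by
    intro t ht
    have := one_sub_inv_le_log_of_pos (show 0 < (t + 1) / t by positivity)
    refine le_trans (le_of_eq ?_) this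
    field_simp
    ring
  refine ⟨V, hVIic, ?_, ?_, ?_, ?_⟩
  · intro r s hr
    have h1 : ENNReal.ofReal (1 / (|s| + 1)) * V (Set.Icc r s) < ⊤ := by
      rw [← setLIntegral_const]
      refine lt_of_le_of_lt ?_ (hfin 1 one_pos)
      refine (setLIntegral_mono' measurableSet_Icc ?_).trans (setLIntegral_le_lintegral _ _)
      intro t ht
      have h0 : 0 < t := hr.trans_le ht.1
      apply ENNReal.ofReal_le_ofReal
      refine le_trans ?_ (hlog t h0)
      have := ht.2.trans (le_abs_self s)
      gcongr
    refine (ENNReal.mul_lt_top_iff.mp h1).elim And.right ?_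
    rintro (h | h)
    · rw [ENNReal.ofReal_eq_zero] at h
      have : 0 < 1 / (|s| + 1) := by positivity
      linarith
    · simp [h]
  · refine lt_of_le_of_lt ?_ (hfin 1 one_pos)
    refine (setLIntegral_mono' measurableSet_Ioc ?_).trans (setLIntegral_le_lintegral _ _)
    intro t ht
    have h0 := ht.1
    apply ENNReal.ofReal_le_ofReal
    rw [abs_of_nonpos (log_nonpos h0.le ht.2), log_div (by linarith) h0.ne']
    have := log_nonneg (show 1 ≤ t + 1 by linarith)
    linarith
  · have h1 : ∫⁻ t in Set.Ici (1:ℝ), ENNReal.ofReal t⁻¹ ∂V ≤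
        2 * ∫⁻ t, ENNReal.ofReal (log ((t + 1) / t)) ∂V := by
      rw [← lintegral_const_mul _ (by fun_prop)]
      refine (setLIntegral_mono' measurableSet_Ici ?_).trans (setLIntegral_le_lintegral _ _)
      intro t ht
      have h1 : (1:ℝ) ≤ t := ht
      have h0 : 0 < t := by linarith
      rw [show (2 : ENNReal) = ENNReal.ofReal 2 by simp, ← ENNReal.ofReal_mul (by norm_num)]
      apply ENNReal.ofReal_le_ofReal
      have := hlog t h0
      have h3 : t⁻¹ ≤ 2 * (1 / (t + 1)) := by
        rw [inv_eq_one_div, mul_one_div, div_le_div_iff₀ h0 (by linarith)]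
        linarith
      linarith
    exact h1.trans_lt (ENNReal.mul_lt_top (by simp) (hfin 1 one_pos))
  · intro s hs
    rcases hs.eq_or_lt with rfl | hs
    · have : ∫ t in Set.Ioi (0:ℝ), log (t / (t + 0)) ∂V = 0 := by
        rw [setIntegral_congr_fun (g := fun _ => (0:ℝ)) measurableSet_Ioi]
        · simp
        · intro t ht
          have : t ≠ 0 := ne_of_gt ht
          simp [div_self this]
      rw [this, hL0]
      simp
    · rw [hrV]
      have h1 : ∫ t, log (t / (t + s)) ∂V = - ∫ t, log ((t + s) / t) ∂V := by
        rw [← integral_neg]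
        congr 1
        ext t
        rw [← log_inv, inv_div]
      have hnn : 0 ≤ᵐ[V] fun t => log ((t + s) / t) := by
        filter_upwards [hVae] with t ht
        apply log_nonneg
        rw [le_div_iff₀ ht]
        linarith
      have hI : Integrable (fun t => log ((t + s) / t)) V := by
        refine ⟨Measurable.aestronglyMeasurable (by fun_prop), ?_⟩
        rw [hasFiniteIntegral_iff_ofReal hnn]
        exact hfin s hs
      have h2 := hN' s hs
      rw [← ofReal_integral_eq_lintegral_ofReal hI hnn, ← ENNReal.ofReal_add (by positivity)
        (integral_nonneg_of_ae hnn)] at h2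
      have h3 : 0 ≤ - log (L s) := by
        have hanti : AntitoneOn L (Set.Ici 0) := by
          apply antitoneOn_of_deriv_nonpos (convex_Ici 0) hcont
          · intro x hx
            rw [interior_Ici] at hx
            exact (hderiv x hx).differentiableAt.differentiableWithinAt
          · intro x hx
            rw [interior_Ici] at hx
            rw [(hderiv x hx).deriv]
            have := hpos x hx
            have := hLpos x (le_of_lt hx)
            nlinarith
        have := hanti (Set.self_mem_Ici) hs.le hs.le
        rw [hL0] at this
        have := log_nonpos (hLpos s hs.le).le this
        linarith
      rw [ENNReal.ofReal_eq_ofReal_iff h3 (add_nonneg (by positivity)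
        (integral_nonneg_of_ae hnn))] at h2
      rw [h1, ← neg_add, ← h2, neg_neg, exp_log (hLpos s hs.le)]

lemma integrable_exp_neg_mul_abs_self {κ : ℝ} (hκ : 0 < κ) :
    Integrable (fun x : ℝ => exp (-κ * |x|)) := by
  rw [← integrableOn_univ, ← Set.Iic_union_Ioi (a := (0:ℝ))]
  refine IntegrableOn.union ?_ ?_
  · refine (integrableOn_exp_mul_Iic hκ 0).congr_fun (fun x hx => ?_) measurableSet_Iic
    simp only
    rw [abs_of_nonpos hx, neg_mul_neg]
  · refine (integrableOn_exp_mul_Ioi (neg_lt_zero.mpr hκ) 0).congr_fun (fun x hx => ?_)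
      measurableSet_Ioi
    rw [abs_of_pos hx]

lemma integrable_add_mul_I_of_norm_le {f : ℂ → ℂ} {τ M κ : ℝ} (hκ : 0 < κ)
    (hf : ∀ z : ℂ, z.im = τ → DifferentiableAt ℂ f z)
    (hb : ∀ z : ℂ, z.im = τ → ‖f z‖ ≤ M * exp (-κ * |z.re|)) :
    Integrable (fun x : ℝ => f (x + τ * Complex.I)) := by
  refine Integrable.mono' ((integrable_exp_neg_mul_abs_self hκ).const_mul M) ?_ ?_
  · apply Continuous.aestronglyMeasurable
    rw [continuous_iff_continuousAt]
    intro x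
    refine ContinuousAt.comp (f := fun x : ℝ => (x + τ * Complex.I : ℂ)) (g := f) ?_ (by fun_prop)
    exact (hf _ (by simp)).continuousAt
  · refine Filter.Eventually.of_forall fun x => ?_
    simpa using hb (x + τ * Complex.I) (by simp)

theorem integral_add_mul_I_eq {f : ℂ → ℂ} {θ M κ : ℝ} (hκ : 0 < κ)
    (hf : ∀ z : ℂ, z.im ∈ Set.uIcc 0 θ → DifferentiableAt ℂ f z)
    (hb : ∀ z : ℂ, z.im ∈ Set.uIcc 0 θ → ‖f z‖ ≤ M * exp (-κ * |z.re|)) :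
    ∫ x : ℝ, f x = ∫ x : ℝ, f (x + θ * Complex.I) := by
  have hint : ∀ τ ∈ Set.uIcc 0 θ, Integrable (fun x : ℝ => f (x + τ * Complex.I)) :=
    fun τ hτ => integrable_add_mul_I_of_norm_le hκ (fun z hz => hf z (hz ▸ hτ))
      (fun z hz => hb z (hz ▸ hτ))
  have hM : 0 ≤ M := by
    have := (norm_nonneg _).trans (hb 0 (by simp))
    simpa using this
  have hrect : ∀ T : ℝ, (∫ x in (-T)..T, f x) - (∫ x in (-T)..T, f (x + θ * Complex.I)) =
      Complex.I • (∫ y in (0:ℝ)..θ, f (((-T : ℝ) : ℂ) + y * Complex.I)) -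
        Complex.I • (∫ y in (0:ℝ)..θ, f (T + y * Complex.I)) := by
    intro T
    have := Complex.integral_boundary_rect_eq_zero_of_differentiableOn f ((-T : ℝ) : ℂ)
      (T + θ * Complex.I) (by
        intro z hz
        have h2 := hz.2
        simp at h2
        exact (hf z (by simpa using h2)).differentiableWithinAt)
    simp at this
    simp only [smul_eq_mul, Complex.ofReal_neg]
    linear_combination this
  have hside : ∀ τ : ℝ → ℝ, (∀ T, |τ T| = |T|) →
      Filter.Tendsto (fun T : ℝ => Complex.I • ∫ y in (0:ℝ)..θ, f ((τ T : ℂ) + y * Complex.I))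
      Filter.atTop (nhds 0) := by
    intro τ hτ
    have h0 : Filter.Tendsto (fun T : ℝ => M * exp (-κ * |T|) * |θ - 0|) Filter.atTop (nhds 0) := by
      have h1 : Filter.Tendsto (fun T : ℝ => -κ * |T|) Filter.atTop Filter.atBot :=
        (Filter.tendsto_abs_atTop_atTop).const_mul_atTop_of_neg (by linarith)
      have := ((tendsto_exp_atBot.comp h1).const_mul M).mul_const |θ - 0|
      simpa using this
    refine squeeze_zero_norm (fun T => ?_) h0
    rw [norm_smul, Complex.norm_I, one_mul]
    apply intervalIntegral.norm_integral_le_of_norm_le_const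
    intro y hy
    have := hb (τ T + y * Complex.I) (by simpa using Set.uIoc_subset_uIcc hy)
    simpa [hτ] using this
  have h1 := (hside (fun T => -T) (fun T => abs_neg T)).sub (hside (fun T => T) (fun T => rfl))
  simp only [← hrect] at h1
  have hi0 : Integrable (fun x : ℝ => f x) := by simpa using hint 0 (by simp)
  have h2 := (intervalIntegral_tendsto_integral hi0 Filter.tendsto_neg_atTop_atBot
      Filter.tendsto_id).sub
    (intervalIntegral_tendsto_integral (hint θ (by simp)) Filter.tendsto_neg_atTop_atBot
      Filter.tendsto_id)
  have := tendsto_nhds_unique h1 h2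
  rw [sub_zero] at this
  exact (sub_eq_zero.mp this.symm)

lemma sin_le_sin_of_mem_Icc {δ x : ℝ} (hδ : 0 < δ) (hx : x ∈ Set.Icc δ (π - δ)) :
    sin δ ≤ sin x := by
  rcases le_total x (π / 2) with h | h
  · exact sin_le_sin_of_le_of_le_pi_div_two (by linarith [pi_pos]) h hx.1
  · rw [← sin_pi_sub x]
    exact sin_le_sin_of_le_of_le_pi_div_two (by linarith [pi_pos]) (by linarith) (by linarith [hx.2])

lemma im_mul_cexp (A : ℂ) (z : ℂ) :
    (A * Complex.exp z).im = ‖A‖ * exp z.re * sin (A.arg + z.im) := by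
  conv_lhs => rw [← Complex.norm_mul_exp_arg_mul_I A]
  rw [mul_assoc, ← Complex.exp_add, Complex.im_ofReal_mul,
    Complex.exp_im]
  simp [mul_assoc]

lemma exists_le_im_add_of_mem_uIcc {A B : ℂ} (hA : 0 < A.im) (hB : 0 < B.im) :
    ∃ m, 0 < m ∧ ∀ z : ℂ, z.im ∈ Set.uIcc 0 (B.arg - A.arg) →
      m * exp (|z.re| / 2) ≤ (A * Complex.exp (z / 2) + B * Complex.exp (-z / 2)).im := by
  have hA1 : 0 < A.arg := by
    rcases (Complex.arg_nonneg_iff.mpr hA.le).lt_or_eq with h | h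
    · exact h
    · have := (Complex.arg_eq_zero_iff.mp h.symm).2
      linarith
  have hB1 : 0 < B.arg := by
    rcases (Complex.arg_nonneg_iff.mpr hB.le).lt_or_eq with h | h
    · exact h
    · have := (Complex.arg_eq_zero_iff.mp h.symm).2
      linarith
  have hA2 : A.arg < π := Complex.arg_lt_pi_iff.mpr (Or.inr hA.ne')
  have hB2 : B.arg < π := Complex.arg_lt_pi_iff.mpr (Or.inr hB.ne')
  set δ := min (min A.arg B.arg) (min (π - A.arg) (π - B.arg)) with hδ
  have hδ0 : 0 < δ := lt_min (lt_min hA1 hB1) (lt_min (by linarith) (by linarith))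
  have hd1 : δ ≤ A.arg := (min_le_left _ _).trans (min_le_left _ _)
  have hd2 : δ ≤ B.arg := (min_le_left _ _).trans (min_le_right _ _)
  have hd3 : δ ≤ π - A.arg := (min_le_right _ _).trans (min_le_left _ _)
  have hd4 : δ ≤ π - B.arg := (min_le_right _ _).trans (min_le_right _ _)
  have hs : 0 < sin δ := sin_pos_of_pos_of_lt_pi hδ0 (by linarith)
  have hA0 : 0 < ‖A‖ := norm_pos_iff.mpr (by rintro rfl; simp at hA)
  have hB0 : 0 < ‖B‖ := norm_pos_iff.mpr (by rintro rfl; simp at hB)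
  refine ⟨min ‖A‖ ‖B‖ * sin δ, mul_pos (lt_min hA0 hB0) hs, fun z hz => ?_⟩
  have hmem : A.arg + z.im / 2 ∈ Set.Icc δ (π - δ) ∧ B.arg + -z.im / 2 ∈ Set.Icc δ (π - δ) := by
    rcases le_total 0 (B.arg - A.arg) with h | h
    · rw [Set.uIcc_of_le h] at hz
      refine ⟨⟨?_, ?_⟩, ⟨?_, ?_⟩⟩ <;> linarith [hz.1, hz.2]
    · rw [Set.uIcc_of_ge h] at hz
      refine ⟨⟨?_, ?_⟩, ⟨?_, ?_⟩⟩ <;> linarith [hz.1, hz.2]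
  have h1 := sin_le_sin_of_mem_Icc hδ0 hmem.1
  have h2 := sin_le_sin_of_mem_Icc hδ0 hmem.2
  have e1 : (z / 2).re = z.re / 2 := by simp
  have e2 : (z / 2).im = z.im / 2 := by simp
  have e3 : (-z / 2).re = -z.re / 2 := by simp
  have e4 : (-z / 2).im = -z.im / 2 := by simp
  rw [Complex.add_im, im_mul_cexp, im_mul_cexp, e1, e2, e3, e4]
  have h3 : min ‖A‖ ‖B‖ * sin δ * exp (z.re / 2) ≤
      ‖A‖ * exp (z.re / 2) * sin (A.arg + z.im / 2) := by
    rw [mul_right_comm]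
    gcongr
    exact min_le_left _ _
  have h4 : min ‖A‖ ‖B‖ * sin δ * exp (-z.re / 2) ≤
      ‖B‖ * exp (-z.re / 2) * sin (B.arg + -z.im / 2) := by
    rw [mul_right_comm]
    gcongr
    exact min_le_right _ _
  have h5 : 0 < min ‖A‖ ‖B‖ * sin δ := mul_pos (lt_min hA0 hB0) hs
  have h6 := mul_pos h5 (exp_pos (z.re / 2))
  have h7 := mul_pos h5 (exp_pos (-z.re / 2))
  rcases abs_choice z.re with h | h <;> rw [h] <;> linarith

lemma ofReal_mul_cpow {ρ : ℝ} (hρ : 0 < ρ) {z : ℂ} (hz : z ≠ 0) (r : ℝ) :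
    ((ρ : ℂ) * z) ^ (r : ℂ) = ((ρ ^ r : ℝ) : ℂ) * z ^ (r : ℂ) := by
  have h1 : (ρ : ℂ) ≠ 0 := Complex.ofReal_ne_zero.mpr hρ.ne'
  rw [Complex.cpow_def_of_ne_zero (mul_ne_zero h1 hz), Complex.log_ofReal_mul hρ hz, add_mul,
    Complex.exp_add, Complex.cpow_def_of_ne_zero hz, rpow_def_of_pos hρ]
  push_cast
  rfl

lemma conj_cpow_ofReal {z : ℂ} (hz : z.arg ≠ π) (r : ℝ) :
    (starRingEnd ℂ z) ^ (r : ℂ) = starRingEnd ℂ (z ^ (r : ℂ)) := by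
  rw [Complex.conj_cpow _ _ hz, Complex.conj_ofReal]

/-- The combination `A e^(z/2) + B e^(-z/2)`. -/
noncomputable def expComb (A B z : ℂ) : ℂ := A * Complex.exp (z / 2) + B * Complex.exp (-z / 2)

lemma differentiable_expComb (A B : ℂ) : Differentiable ℂ (expComb A B) := by
  unfold expComb
  fun_prop

lemma expComb_conj (A B z : ℂ) : expComb (starRingEnd ℂ B) (starRingEnd ℂ A) z =
    starRingEnd ℂ (expComb A B (-(starRingEnd ℂ z))) := by
  simp only [expComb, map_add, map_mul, ← Complex.exp_conj, map_div₀, map_neg, Complex.conj_conj,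
    neg_neg, map_ofNat]
  ring

lemma mul_cexp_eq (A w : ℂ) : A * Complex.exp w = ‖A‖ * Complex.exp (A.arg * Complex.I + w) := by
  rw [Complex.exp_add, ← mul_assoc, Complex.norm_mul_exp_arg_mul_I]

lemma expComb_shift (A B : ℂ) (x : ℝ) :
    expComb A B (x + (B.arg - A.arg : ℝ) * Complex.I) =
      ((‖A‖ * exp (x / 2) + ‖B‖ * exp (-x / 2) : ℝ) : ℂ) *
        Complex.exp (((A.arg + B.arg) / 2 : ℝ) * Complex.I) := by
  rw [expComb, mul_cexp_eq A, mul_cexp_eq B]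
  push_cast
  rw [add_mul, mul_assoc, mul_assoc, ← Complex.exp_add, ← Complex.exp_add]
  congr 3 <;> ring

lemma expComb_conj_shift (A B : ℂ) (x : ℝ) :
    expComb (starRingEnd ℂ B) (starRingEnd ℂ A) (x + (B.arg - A.arg : ℝ) * Complex.I) =
      ((‖A‖ * exp (-x / 2) + ‖B‖ * exp (x / 2) : ℝ) : ℂ) *
        starRingEnd ℂ (Complex.exp (((A.arg + B.arg) / 2 : ℝ) * Complex.I)) := by
  rw [expComb_conj, show -(starRingEnd ℂ (x + (B.arg - A.arg : ℝ) * Complex.I)) =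
    ((-x : ℝ) : ℂ) + (B.arg - A.arg : ℝ) * Complex.I by
      simp [-Complex.ofReal_sub]; ring,
    expComb_shift, map_mul, Complex.conj_ofReal, neg_neg]

lemma arg_pos_of_im_pos {A : ℂ} (hA : 0 < A.im) : 0 < A.arg ∧ A.arg < π := by
  refine ⟨?_, Complex.arg_lt_pi_iff.mpr (Or.inr hA.ne')⟩
  rcases (Complex.arg_nonneg_iff.mpr hA.le).lt_or_eq with h | h
  · exact h
  · have := (Complex.arg_eq_zero_iff.mp h.symm).2
    linarith

lemma expComb_cpow_shift {A B : ℂ} (hA : 0 < A.im) (hB : 0 < B.im) (r x : ℝ) :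
    ∃ w : ℝ, 0 < w ∧ expComb A B (x + (B.arg - A.arg : ℝ) * Complex.I) ^ (r : ℂ) *
      expComb (starRingEnd ℂ B) (starRingEnd ℂ A) (x + (B.arg - A.arg : ℝ) * Complex.I) ^ (r : ℂ)
      = w := by
  have hA0 : 0 < ‖A‖ := norm_pos_iff.mpr (by rintro rfl; simp at hA)
  have hB0 : 0 < ‖B‖ := norm_pos_iff.mpr (by rintro rfl; simp at hB)
  have h1 : 0 < ‖A‖ * exp (x / 2) + ‖B‖ * exp (-x / 2) := by positivity
  have h2 : 0 < ‖A‖ * exp (-x / 2) + ‖B‖ * exp (x / 2) := by positivity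
  obtain ⟨hA1, hA2⟩ := arg_pos_of_im_pos hA
  obtain ⟨hB1, hB2⟩ := arg_pos_of_im_pos hB
  rw [expComb_shift, expComb_conj_shift]
  set E := Complex.exp (((A.arg + B.arg) / 2 : ℝ) * Complex.I) with hE
  have hE0 : E ≠ 0 := Complex.exp_ne_zero _
  have hEarg : E.arg ≠ π := by
    rw [hE, Complex.arg_exp_mul_I, (toIocMod_eq_self _).mpr]
    · linarith
    · exact ⟨by linarith, by linarith⟩
  rw [ofReal_mul_cpow h1 hE0, ofReal_mul_cpow h2 ((map_ne_zero _).mpr hE0), conj_cpow_ofReal hEarg]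
  refine ⟨_ * _ * Complex.normSq (E ^ (r : ℂ)), mul_pos (mul_pos (rpow_pos_of_pos h1 r)
    (rpow_pos_of_pos h2 r)) (Complex.normSq_pos.mpr ?_), ?_⟩
  · rw [Complex.cpow_def_of_ne_zero hE0]
    exact Complex.exp_ne_zero _
  · push_cast
    rw [← Complex.mul_conj]
    ring

lemma im_expComb_div_shift {A B : ℂ} (hA : 0 < A.im) (hB : 0 < B.im) {C D : ℝ} (hC : 0 ≤ C)
    (hD : 0 ≤ D) (x : ℝ) :
    (expComb C D (x + (B.arg - A.arg : ℝ) * Complex.I) /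
      expComb A B (x + (B.arg - A.arg : ℝ) * Complex.I)).im ≤ 0 := by
  have hA0 : 0 < ‖A‖ := norm_pos_iff.mpr (by rintro rfl; simp at hA)
  have hB0 : 0 < ‖B‖ := norm_pos_iff.mpr (by rintro rfl; simp at hB)
  have h1 : 0 < ‖A‖ * exp (x / 2) + ‖B‖ * exp (-x / 2) := by positivity
  obtain ⟨hA1, hA2⟩ := arg_pos_of_im_pos hA
  obtain ⟨hB1, hB2⟩ := arg_pos_of_im_pos hB
  have e : expComb C D (x + (B.arg - A.arg : ℝ) * Complex.I) =
      (((C * exp (x / 2) : ℝ) : ℂ) * Complex.exp ((-A.arg : ℝ) * Complex.I) +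
        ((D * exp (-x / 2) : ℝ) : ℂ) * Complex.exp ((-B.arg : ℝ) * Complex.I)) *
        Complex.exp (((A.arg + B.arg) / 2 : ℝ) * Complex.I) := by
    rw [expComb]
    push_cast
    rw [add_mul, mul_assoc, mul_assoc, mul_assoc, mul_assoc, ← Complex.exp_add, ← Complex.exp_add,
      ← Complex.exp_add, ← Complex.exp_add]
    congr 3 <;> ring
  rw [e, expComb_shift, mul_div_mul_right _ _ (Complex.exp_ne_zero _), Complex.div_ofReal_im]
  apply div_nonpos_of_nonpos_of_nonneg _ h1.le
  rw [Complex.add_im, Complex.im_ofReal_mul, Complex.im_ofReal_mul, Complex.exp_ofReal_mul_I_im,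
    Complex.exp_ofReal_mul_I_im, sin_neg, sin_neg]
  have := sin_nonneg_of_nonneg_of_le_pi hA1.le hA2.le
  have := sin_nonneg_of_nonneg_of_le_pi hB1.le hB2.le
  have h3 : 0 ≤ C * exp (x / 2) * sin A.arg := by positivity
  have h4 : 0 ≤ D * exp (-x / 2) * sin B.arg := by positivity
  linarith

lemma expComb_strip {A B : ℂ} (hA : 0 < A.im) (hB : 0 < B.im) {k : ℝ} (hk : 0 < k) {W : ℂ → ℂ}
    {M : ℝ}
    (hW : ∀ z : ℂ, z.im ∈ Set.uIcc 0 (B.arg - A.arg) → DifferentiableAt ℂ W z)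
    (hWb : ∀ z : ℂ, z.im ∈ Set.uIcc 0 (B.arg - A.arg) → ‖W z‖ ≤ M) :
    (∃ M', ∀ z : ℂ, z.im ∈ Set.uIcc 0 (B.arg - A.arg) →
      ‖expComb A B z ^ ((-k : ℝ) : ℂ) *
        expComb (starRingEnd ℂ B) (starRingEnd ℂ A) z ^ ((-k : ℝ) : ℂ) * W z‖ ≤
        M' * exp (-k * |z.re|)) ∧
    (∀ z : ℂ, z.im ∈ Set.uIcc 0 (B.arg - A.arg) → DifferentiableAt ℂ
      (fun z => expComb A B z ^ ((-k : ℝ) : ℂ) *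
        expComb (starRingEnd ℂ B) (starRingEnd ℂ A) z ^ ((-k : ℝ) : ℂ) * W z) z) := by
  obtain ⟨m, hm, hP⟩ := exists_le_im_add_of_mem_uIcc hA hB
  have hP' : ∀ z : ℂ, z.im ∈ Set.uIcc 0 (B.arg - A.arg) →
      m * exp (|z.re| / 2) ≤ (expComb A B z).im := hP
  have hQ' : ∀ z : ℂ, z.im ∈ Set.uIcc 0 (B.arg - A.arg) →
      (expComb (starRingEnd ℂ B) (starRingEnd ℂ A) z).im ≤ - (m * exp (|z.re| / 2)) := by
    intro z hz
    rw [expComb_conj, Complex.conj_im]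
    have := hP' (-(starRingEnd ℂ z)) (by simpa using hz)
    simp only [Complex.neg_re, Complex.conj_re, abs_neg] at this
    linarith
  refine ⟨⟨m ^ (-k) * m ^ (-k) * M, fun z hz => ?_⟩, fun z hz => ?_⟩
  · have hpos : 0 < m * exp (|z.re| / 2) := by positivity
    rw [norm_mul, norm_mul, Complex.norm_cpow_real, Complex.norm_cpow_real]
    have e : m ^ (-k) * m ^ (-k) * M * exp (-k * |z.re|) =
        (m * exp (|z.re| / 2)) ^ (-k) * (m * exp (|z.re| / 2)) ^ (-k) * M := by
      rw [mul_rpow hm.le (exp_pos _).le, ← exp_mul,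
        show exp (-k * |z.re|) = exp (|z.re| / 2 * -k) * exp (|z.re| / 2 * -k) by
          rw [← exp_add]; congr 1; ring]
      ring
    rw [e]
    have h1 := rpow_le_rpow_of_nonpos hpos
      (((hP' z hz).trans (le_abs_self _)).trans (Complex.abs_im_le_norm _)) (neg_nonpos.mpr hk.le)
    have h2 := rpow_le_rpow_of_nonpos hpos
      (((le_neg_of_le_neg (hQ' z hz)).trans (neg_le_abs _)).trans (Complex.abs_im_le_norm _))
      (neg_nonpos.mpr hk.le)
    gcongr
    exact hWb z hz
  · have hpos : 0 < m * exp (|z.re| / 2) := by positivity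
    refine DifferentiableAt.mul (DifferentiableAt.mul ?_ ?_) (hW z hz)
    · refine DifferentiableAt.cpow (differentiable_expComb _ _ z) (by fun_prop) ?_
      exact Or.inr (ne_of_gt <| by linarith [hP' z hz])
    · refine DifferentiableAt.cpow (differentiable_expComb _ _ z) (by fun_prop) ?_
      exact Or.inr (ne_of_lt <| by linarith [hQ' z hz])

theorem re_integral_expComb_pos {A B : ℂ} (hA : 0 < A.im) (hB : 0 < B.im) {k : ℝ} (hk : 0 < k) :
    0 < (∫ x : ℝ, expComb A B x ^ ((-k : ℝ) : ℂ) *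
      expComb (starRingEnd ℂ B) (starRingEnd ℂ A) x ^ ((-k : ℝ) : ℂ)).re := by
  obtain ⟨⟨M, h1⟩, h2⟩ := expComb_strip hA hB hk (W := fun _ => 1) (M := 1) (by simp) (by simp)
  simp only [mul_one] at h1 h2
  have hi := integrable_add_mul_I_of_norm_le hk (τ := B.arg - A.arg) (fun z hz => h2 z (by simp [hz]))
    (fun z hz => h1 z (by simp [hz]))
  rw [integral_add_mul_I_eq hk h2 h1]
  choose w hw0 hw using expComb_cpow_shift hA hB (-k)
  simp only [hw] at hi ⊢
  rw [integral_complex_ofReal, Complex.ofReal_re]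
  have hi' : Integrable w := by simpa using hi.re
  rw [integral_pos_iff_support_of_nonneg (fun x => (hw0 x).le) hi',
    show Function.support w = Set.univ from Set.eq_univ_of_forall fun x => (hw0 x).ne']
  simp

theorem im_integral_expComb_nonpos {A B : ℂ} (hA : 0 < A.im) (hB : 0 < B.im) {k : ℝ} (hk : 0 < k)
    {C D : ℝ} (hC : 0 ≤ C) (hD : 0 ≤ D) :
    (∫ x : ℝ, expComb A B x ^ ((-k : ℝ) : ℂ) *
      expComb (starRingEnd ℂ B) (starRingEnd ℂ A) x ^ ((-k : ℝ) : ℂ) *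
      (expComb C D x / expComb A B x)).im ≤ 0 := by
  obtain ⟨m, hm, hP⟩ := exists_le_im_add_of_mem_uIcc hA hB
  have hP' : ∀ z : ℂ, z.im ∈ Set.uIcc 0 (B.arg - A.arg) →
      m * exp (|z.re| / 2) ≤ ‖expComb A B z‖ := fun z hz =>
    ((hP z hz).trans (le_abs_self _)).trans (Complex.abs_im_le_norm _)
  obtain ⟨⟨M, h1⟩, h2⟩ := expComb_strip hA hB hk (W := fun z => expComb C D z / expComb A B z)
    (M := (C + D) / m) (by
      intro z hz
      refine (differentiable_expComb _ _ z).div (differentiable_expComb _ _ z) ?_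
      rw [← norm_pos_iff]
      exact (by positivity : 0 < m * exp (|z.re| / 2)).trans_le (hP' z hz)) (by
      intro z hz
      rw [norm_div]
      have h3 : ‖expComb C D z‖ ≤ (C + D) * exp (|z.re| / 2) := by
        rw [expComb, add_mul]
        refine (norm_add_le _ _).trans (add_le_add ?_ ?_)
        · rw [norm_mul, Complex.norm_exp, Complex.norm_real, norm_of_nonneg hC]
          gcongr
          simpa using div_le_div_of_nonneg_right (le_abs_self z.re) (by norm_num : (0:ℝ) ≤ 2)
        · rw [norm_mul, Complex.norm_exp, Complex.norm_real, norm_of_nonneg hD]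
          gcongr
          simpa using div_le_div_of_nonneg_right (neg_le_abs z.re) (by norm_num : (0:ℝ) ≤ 2)
      calc ‖expComb C D z‖ / ‖expComb A B z‖ ≤
            ((C + D) * exp (|z.re| / 2)) / (m * exp (|z.re| / 2)) := by
            have := hP' z hz
            gcongr
        _ = (C + D) / m := mul_div_mul_right _ _ (exp_pos _).ne')
  have hi := integrable_add_mul_I_of_norm_le hk (τ := B.arg - A.arg) (fun z hz => h2 z (by simp [hz]))
    (fun z hz => h1 z (by simp [hz]))
  rw [integral_add_mul_I_eq hk h2 h1]
  choose w hw0 hw using expComb_cpow_shift hA hB (-k)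
  simp only [hw] at hi ⊢
  have := integral_im hi
  simp only [RCLike.im_to_complex] at this
  rw [← this]
  apply integral_nonpos
  intro x
  simp only [Complex.im_ofReal_mul, Pi.zero_apply]
  exact mul_nonpos_of_nonneg_of_nonpos (hw0 x).le (im_expComb_div_shift hA hB hC hD x)

lemma integral_Ioo_eq_integral_log {c : ℝ} (hc : 0 < c) (g : ℝ → ℂ) :
    ∫ b in Set.Ioo (-c) c, g b = ∫ z : ℝ, ((exp z * (exp c ^ 2 - 1) /
      ((exp z * exp c + 1) * (exp z + exp c)) : ℝ) : ℂ) *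
        g (log ((exp z * exp c + 1) / (exp z + exp c))) := by
  have hC : 1 < exp c := one_lt_exp_iff.mpr hc
  have hC2 : 0 < exp c ^ 2 - 1 := by nlinarith
  set C := exp c with hCdef
  have hC0 : 0 < C := by linarith
  have himg : (fun z : ℝ => log ((exp z * C + 1) / (exp z + C))) '' Set.univ = Set.Ioo (-c) c := by
    ext b
    simp only [Set.image_univ, Set.mem_range, Set.mem_Ioo]
    constructor
    · rintro ⟨z, rfl⟩
      have hz := exp_pos z
      constructor
      · rw [lt_log_iff_exp_lt (by positivity), exp_neg, ← hCdef, lt_div_iff₀ (by positivity),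
          inv_mul_lt_iff₀ hC0]
        nlinarith
      · rw [log_lt_iff_lt_exp (by positivity), ← hCdef, div_lt_iff₀ (by positivity)]
        nlinarith
    · rintro ⟨h1, h2⟩
      have h3 : exp b < C := exp_lt_exp.mpr h2
      have h4 : 1 < exp b * C := by
        rw [hCdef, ← exp_add]
        exact one_lt_exp_iff.mpr (by linarith)
      have h5 : 0 < (exp b * C - 1) / (C - exp b) := div_pos (by linarith) (by linarith)
      have h6 : C - exp b ≠ 0 := by linarith
      refine ⟨log ((exp b * C - 1) / (C - exp b)), ?_⟩
      rw [exp_log h5]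
      have : ((exp b * C - 1) / (C - exp b) * C + 1) / ((exp b * C - 1) / (C - exp b) + C) =
          exp b := by
        rw [div_eq_iff (by positivity)]
        field_simp
        ring
      rw [this, log_exp]
  have hd : ∀ z ∈ Set.univ, HasDerivWithinAt (fun z : ℝ => log ((exp z * C + 1) / (exp z + C)))
      (exp z * (C ^ 2 - 1) / ((exp z * C + 1) * (exp z + C))) Set.univ z := by
    intro z _
    rw [hasDerivWithinAt_univ]
    have hz := exp_pos z
    have h1 : HasDerivAt (fun z => exp z * C + 1) (exp z * C) z :=
      ((hasDerivAt_exp z).mul_const C).add_const 1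
    have h2 : HasDerivAt (fun z => exp z + C) (exp z) z := (hasDerivAt_exp z).add_const C
    refine ((h1.div h2 (by positivity)).log (by simp only [Pi.div_apply]; positivity)).congr_deriv ?_
    simp only [Pi.div_apply]
    field_simp
    ring
  have hinj : Set.InjOn (fun z : ℝ => log ((exp z * C + 1) / (exp z + C))) Set.univ := by
    intro x _ y _ hxy
    have hx := exp_pos x
    have hy := exp_pos y
    have h1 := log_injOn_pos (Set.mem_Ioi.mpr (by positivity)) (Set.mem_Ioi.mpr (by positivity)) hxy
    rw [div_eq_div_iff (by positivity) (by positivity)] at h1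
    have h2 : (exp x - exp y) * (C ^ 2 - 1) = 0 := by linear_combination h1
    rcases mul_eq_zero.mp h2 with h | h
    · exact exp_injective (by linarith)
    · linarith
  rw [← himg, integral_image_eq_integral_abs_deriv_smul MeasurableSet.univ hd hinj,
    Measure.restrict_univ]
  congr 1
  ext z
  have hz := exp_pos z
  rw [abs_of_pos (by positivity), Complex.real_smul]

section Kernel

variable {s : ℂ} {c k : ℝ}

lemma kernel_pointwise (hs : 0 < s.im) (hc : 0 < c) (z : ℝ) :
    ((exp z * (exp c ^ 2 - 1) / ((exp z * exp c + 1) * (exp z + exp c)) : ℝ) : ℂ) *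
      ((1 + s * exp (log ((exp z * exp c + 1) / (exp z + exp c)))) ^ ((-k : ℝ) : ℂ) *
      (1 + starRingEnd ℂ s * exp (-(log ((exp z * exp c + 1) / (exp z + exp c))))) ^
        ((-k : ℝ) : ℂ) *
      (((2 * cosh c - 2 * cosh (log ((exp z * exp c + 1) / (exp z + exp c)))) ^ (k - 1) : ℝ) : ℂ)) =
    ((((exp c ^ 2 - 1) ^ 2 / exp c) ^ (k - 1) * (exp c ^ 2 - 1) : ℝ) : ℂ) *
      (expComb (1 + s * exp c) (exp c + s) z ^ ((-k : ℝ) : ℂ) *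
      expComb (starRingEnd ℂ (exp c + s)) (starRingEnd ℂ (1 + s * exp c)) z ^ ((-k : ℝ) : ℂ)) ∧
    (exp (log ((exp z * exp c + 1) / (exp z + exp c))) : ℂ) /
      (1 + s * exp (log ((exp z * exp c + 1) / (exp z + exp c)))) =
      expComb (exp c : ℝ) (1 : ℝ) z / expComb (1 + s * exp c) (exp c + s) z := by
  have hC : 1 < exp c := one_lt_exp_iff.mpr hc
  have hC2 : 0 < exp c ^ 2 - 1 := by nlinarith
  have hcosh : 2 * cosh c = exp c + (exp c)⁻¹ := by rw [cosh_eq, exp_neg]; ring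
  set C := exp c with hCdef
  have hC0 : 0 < C := by linarith
  have hw : exp z = exp (z / 2) ^ 2 := by rw [← exp_nat_mul]; congr 1; push_cast; ring
  have hwc : Complex.exp ((z : ℂ) / 2) = ((exp (z / 2) : ℝ) : ℂ) := by push_cast; rfl
  have hwc' : Complex.exp (-(z : ℂ) / 2) = ((exp (z / 2) : ℝ) : ℂ)⁻¹ := by
    rw [← hwc, ← Complex.exp_neg]
    congr 1
    ring
  simp only [hw]
  set v := exp (z / 2) with hv
  have hv0 : 0 < v := exp_pos _
  have hvc : (v : ℂ) ≠ 0 := Complex.ofReal_ne_zero.mpr hv0.ne'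
  set N := v ^ 2 * C + 1 with hN
  set D := v ^ 2 + C with hD
  have hN0 : 0 < N := by positivity
  have hD0 : 0 < D := by positivity
  have hNc : (N : ℂ) ≠ 0 := Complex.ofReal_ne_zero.mpr hN0.ne'
  have hDc : (D : ℂ) ≠ 0 := Complex.ofReal_ne_zero.mpr hD0.ne'
  have hND : 0 < N / D := by positivity
  rw [exp_neg, exp_log hND, cosh_eq (log (N / D)), exp_neg, exp_log hND]
  have hP : expComb (1 + s * C) (C + s) z = (D + s * N) / v := by
    rw [expComb, hwc, hwc', hN, hD]
    push_cast
    field_simp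
    ring
  have hQ : expComb (starRingEnd ℂ (C + s)) (starRingEnd ℂ (1 + s * C)) z =
      (N + starRingEnd ℂ s * D) / v := by
    rw [expComb, hwc, hwc', hN, hD]
    simp only [map_add, map_mul, Complex.conj_ofReal, map_one]
    push_cast
    field_simp
    ring
  have hR : expComb (C : ℝ) (1 : ℝ) z = N / v := by
    rw [expComb, hwc, hwc', hN]
    push_cast
    field_simp
  have hDsN : (D + s * N : ℂ) ≠ 0 := by
    intro h
    have := congrArg Complex.im h
    simp at this
    rcases this with h | h <;> linarith
  have hNsD : (N + starRingEnd ℂ s * D : ℂ) ≠ 0 := by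
    intro h
    have := congrArg Complex.im h
    simp at this
    rcases this with h | h <;> linarith
  have e1 : (1 + s * ((N / D : ℝ) : ℂ)) = ((v / D : ℝ) : ℂ) * ((D + s * N) / v) := by
    push_cast
    field_simp
  have e2 : (1 + starRingEnd ℂ s * (((N / D)⁻¹ : ℝ) : ℂ)) =
      ((v / N : ℝ) : ℂ) * ((N + starRingEnd ℂ s * D) / v) := by
    push_cast
    field_simp
  constructor
  · rw [hP, hQ, e1, e2, ofReal_mul_cpow (by positivity) (div_ne_zero hDsN hvc),
      ofReal_mul_cpow (by positivity) (div_ne_zero hNsD hvc)]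
    have e3 : 2 * cosh c - 2 * ((N / D + (N / D)⁻¹) / 2) =
        (v ^ 2 / (N * D)) * ((C ^ 2 - 1) ^ 2 / C) := by
      rw [hcosh, hN, hD]
      field_simp
      ring
    have e4 : v ^ 2 * (C ^ 2 - 1) / (N * D) * ((v / D) ^ (-k) * (v / N) ^ (-k) *
        (2 * cosh c - 2 * ((N / D + (N / D)⁻¹) / 2)) ^ (k - 1)) =
        ((C ^ 2 - 1) ^ 2 / C) ^ (k - 1) * (C ^ 2 - 1) := by
      rw [e3, ← mul_rpow (x := v / D) (y := v / N) (by positivity) (by positivity),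
        mul_rpow (x := v ^ 2 / (N * D)) (by positivity) (by positivity),
        show v / D * (v / N) = v ^ 2 / (N * D) by field_simp,
        show v ^ 2 * (C ^ 2 - 1) / (N * D) = v ^ 2 / (N * D) * (C ^ 2 - 1) by ring]
      set q := v ^ 2 / (N * D) with hq
      have hq0 : 0 < q := by positivity
      have : q * (q ^ (-k) * q ^ (k - 1)) = 1 := by
        rw [← rpow_add hq0, show -k + (k - 1) = -1 by ring, rpow_neg_one, mul_inv_cancel₀ hq0.ne']
      linear_combination (((C ^ 2 - 1) ^ 2 / C) ^ (k - 1) * (C ^ 2 - 1)) * this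
    rw [← e4]
    push_cast
    ring
  · rw [hP, hR, e1]
    push_cast
    field_simp

theorem re_kernel_integral_pos (hs : 0 < s.im) (hc : 0 < c) (hk : 0 < k) :
    0 < (∫ b in Set.Ioo (-c) c, (1 + s * exp b) ^ ((-k : ℝ) : ℂ) *
      (1 + starRingEnd ℂ s * exp (-b)) ^ ((-k : ℝ) : ℂ) *
      (((2 * cosh c - 2 * cosh b) ^ (k - 1) : ℝ) : ℂ)).re := by
  have hC : 1 < exp c := one_lt_exp_iff.mpr hc
  have hC2 : 0 < exp c ^ 2 - 1 := by nlinarith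
  rw [integral_Ioo_eq_integral_log hc]
  simp only [(kernel_pointwise hs hc _).1]
  rw [integral_const_mul, Complex.re_ofReal_mul]
  refine mul_pos (by positivity) (re_integral_expComb_pos ?_ ?_ hk)
  · simp only [Complex.add_im, Complex.one_im, Complex.im_mul_ofReal, zero_add]
    positivity
  · simpa using hs

theorem im_kernel_integral_nonpos (hs : 0 < s.im) (hc : 0 < c) (hk : 0 < k) :
    (∫ b in Set.Ioo (-c) c, (1 + s * exp b) ^ ((-k : ℝ) : ℂ) *
      (1 + starRingEnd ℂ s * exp (-b)) ^ ((-k : ℝ) : ℂ) *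
      (((2 * cosh c - 2 * cosh b) ^ (k - 1) : ℝ) : ℂ) * (exp b / (1 + s * exp b))).im ≤ 0 := by
  have hC : 1 < exp c := one_lt_exp_iff.mpr hc
  have hC2 : 0 < exp c ^ 2 - 1 := by nlinarith
  rw [integral_Ioo_eq_integral_log hc]
  rw [integral_congr_ae (g := fun z : ℝ =>
    ((((exp c ^ 2 - 1) ^ 2 / exp c) ^ (k - 1) * (exp c ^ 2 - 1) : ℝ) : ℂ) *
      (expComb (1 + s * exp c) (exp c + s) z ^ ((-k : ℝ) : ℂ) *
      expComb (starRingEnd ℂ (exp c + s)) (starRingEnd ℂ (1 + s * exp c)) z ^ ((-k : ℝ) : ℂ) *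
      (expComb (exp c : ℝ) (1 : ℝ) z / expComb (1 + s * exp c) (exp c + s) z)))
    (Filter.Eventually.of_forall fun z => by
      obtain ⟨h1, h2⟩ := kernel_pointwise (k := k) hs hc z
      simp only
      rw [← h2, ← mul_assoc _ _ ((_ : ℂ) / _), ← mul_assoc _ _ ((_ : ℂ) / _), h1, mul_assoc])]
  rw [integral_const_mul, Complex.im_ofReal_mul]
  refine mul_nonpos_of_nonneg_of_nonpos (by positivity)
    (im_integral_expComb_nonpos ?_ ?_ hk (exp_pos c).le zero_le_one)
  · simp only [Complex.add_im, Complex.one_im, Complex.im_mul_ofReal, zero_add]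
    positivity
  · simpa using hs

end Kernel

theorem two_cosh_lt_iff {b lam : ℝ} (hl : 2 < lam) :
    2 * cosh b < lam ↔ b ∈ Set.Ioo (-(Real.arcosh (lam / 2))) (Real.arcosh (lam / 2)) := by
  have hc : 0 < Real.arcosh (lam / 2) := Real.arcosh_pos (by linarith)
  have h1 : cosh (Real.arcosh (lam / 2)) = lam / 2 := Real.cosh_arcosh (by linarith)
  have h2 := @Real.cosh_lt_cosh b (Real.arcosh (lam / 2))
  rw [h1, abs_of_pos hc, abs_lt] at h2
  rw [Set.mem_Ioo, ← h2]
  constructor <;> intro h <;> linarith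

set_option maxHeartbeats 1000000 in
theorem re_integral_mixture_nonneg {k : ℝ} {q : ℝ → ENNReal} {H : Measure ℝ} [SFinite H]
    (hq : ∀ᵐ b, q b = ∫⁻ lam in Set.Ioi (2 * cosh b),
      ENNReal.ofReal ((lam - 2 * cosh b) ^ (k - 1)) ∂H)
    (hqtop : ∀ b, q b ≠ ⊤) {κ : ℝ → ℂ} (hκ : Measurable κ)
    (hint : Integrable (fun b => (q b).toReal • κ b))
    (hpos : ∀ c, 0 < c → 0 ≤ (∫ b in Set.Ioo (-c) c,
      κ b * (((2 * cosh c - 2 * cosh b) ^ (k - 1) : ℝ) : ℂ)).re) :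
    0 ≤ (∫ b, (q b).toReal • κ b).re ∧
      ((∀ c, 0 < c → 0 < (∫ b in Set.Ioo (-c) c,
        κ b * (((2 * cosh c - 2 * cosh b) ^ (k - 1) : ℝ) : ℂ)).re) →
      (∫ b, (q b).toReal • κ b).re = 0 → ∀ᵐ b, q b = 0) := by
  set W : ℝ → ℝ → ENNReal := fun b lam =>
    (Set.Ioi (2 * cosh b)).indicator
      (fun lam => ENNReal.ofReal ((lam - 2 * cosh b) ^ (k - 1))) lam with hWdef
  have hWm : Measurable (Function.uncurry W) := by
    have : Function.uncurry W = Set.indicator {p : ℝ × ℝ | 2 * cosh p.1 < p.2}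
        (fun p => ENNReal.ofReal ((p.2 - 2 * cosh p.1) ^ (k - 1))) := by
      ext p
      simp [W, Function.uncurry, Set.indicator_apply]
    rw [this]
    refine Measurable.indicator ?_ (measurableSet_lt (by fun_prop) (by fun_prop))
    fun_prop
  have hWtop : ∀ b lam, W b lam ≠ ⊤ := by
    intro b lam
    simp only [W, Set.indicator_apply]
    split_ifs <;> simp
  have hqW : ∀ᵐ b, q b = ∫⁻ lam, W b lam ∂H := by
    filter_upwards [hq] with b hb
    rw [hb, lintegral_indicator measurableSet_Ioi]
  have hWb : ∀ b, Measurable (W b) := fun b => hWm.comp measurable_prodMk_left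
  set Φ : ℝ → ℝ → ℂ := fun b lam => (W b lam).toReal • κ b with hΦdef
  have hΦm : Measurable (Function.uncurry Φ) :=
    (hWm.ennreal_toReal).smul (hκ.comp measurable_fst)
  have hΦi : Integrable (Function.uncurry Φ) (volume.prod H) := by
    refine ⟨hΦm.aestronglyMeasurable, ?_⟩
    rw [HasFiniteIntegral, lintegral_prod _ hΦm.enorm.aemeasurable]
    refine lt_of_eq_of_lt ?_ hint.2
    refine lintegral_congr_ae ?_
    filter_upwards [hqW] with b hb
    have e1 : ∀ x : ENNReal, x ≠ ⊤ → ‖x.toReal • κ b‖ₑ = x * ‖κ b‖ₑ := by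
      intro x hx
      rw [enorm_smul, Real.enorm_of_nonneg ENNReal.toReal_nonneg, ENNReal.ofReal_toReal hx]
    rw [e1 _ (hqtop b), hb, ← lintegral_mul_const _ (hWb b)]
    exact lintegral_congr fun lam => e1 _ (hWtop b lam)
  have hswap : ∫ b, (q b).toReal • κ b = ∫ lam, (∫ b, Φ b lam) ∂H := by
    rw [← integral_integral_swap hΦi]
    refine integral_congr_ae ?_
    filter_upwards [hqW] with b hb
    simp only [Φ]
    rw [integral_smul_const, integral_toReal (hWb b).aemeasurable
      (Filter.Eventually.of_forall fun lam => (hWtop b lam).lt_top), hb]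
  have hJi : Integrable (fun lam => ∫ b, Φ b lam) H := hΦi.integral_prod_right
  have hJ0 : ∀ lam, lam ≤ 2 → ∫ b, Φ b lam = 0 := by
    intro lam hl
    have : ∀ b, Φ b lam = 0 := by
      intro b
      have : lam ∉ Set.Ioi (2 * cosh b) := by
        have := Real.one_le_cosh b
        simp only [Set.mem_Ioi, not_lt]
        linarith
      simp only [Φ, W, Set.indicator_of_notMem this, ENNReal.toReal_zero, zero_smul]
    simp [this]
  have hJ1 : ∀ lam, 2 < lam → ∫ b, Φ b lam =
      ∫ b in Set.Ioo (-(Real.arcosh (lam / 2))) (Real.arcosh (lam / 2)), κ b *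
        (((2 * cosh (Real.arcosh (lam / 2)) - 2 * cosh b) ^ (k - 1) : ℝ) : ℂ) := by
    intro lam hl
    rw [← integral_indicator measurableSet_Ioo]
    congr 1
    ext b
    have h1 : cosh (Real.arcosh (lam / 2)) = lam / 2 := Real.cosh_arcosh (by linarith)
    by_cases hb : 2 * cosh b < lam
    · rw [Set.indicator_of_mem ((two_cosh_lt_iff hl).1 hb)]
      simp only [Φ, W]
      rw [Set.indicator_of_mem (Set.mem_Ioi.2 hb), ENNReal.toReal_ofReal
        (Real.rpow_nonneg (by linarith) _), h1, Complex.real_smul, mul_comm,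
        mul_div_cancel₀ _ (two_ne_zero)]
    · rw [Set.indicator_of_notMem (fun h => hb ((two_cosh_lt_iff hl).2 h))]
      simp only [Φ, W]
      rw [Set.indicator_of_notMem (by simpa using hb)]
      simp
  have hre : (∫ lam, (∫ b, Φ b lam) ∂H).re = ∫ lam, (∫ b, Φ b lam).re ∂H :=
    (integral_re hJi).symm
  have hJnn : ∀ lam, 0 ≤ (∫ b, Φ b lam).re := by
    intro lam
    rcases le_or_gt lam 2 with hl | hl
    · simp [hJ0 lam hl]
    · rw [hJ1 lam hl]
      exact hpos _ (Real.arcosh_pos (by linarith))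
  refine ⟨?_, ?_⟩
  · rw [hswap, hre]
    exact integral_nonneg hJnn
  · intro hst h0
    rw [hswap, hre, integral_eq_zero_iff_of_nonneg hJnn hJi.re] at h0
    have hH : H (Set.Ioi 2) = 0 := by
      refine measure_mono_null (fun lam hl => ?_) (ae_iff.1 h0)
      simp only [Set.mem_ofPred_eq, Pi.zero_apply]
      rw [hJ1 lam hl]
      exact (hst _ (Real.arcosh_pos (by have := Set.mem_Ioi.1 hl; linarith))).ne'
    filter_upwards [hq] with b hb
    rw [hb]
    refine setLIntegral_measure_zero _ _ (measure_mono_null ?_ hH)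
    intro x hx
    have := Real.one_le_cosh b
    simp only [Set.mem_Ioi] at hx ⊢
    linarith

theorem exists_map_sum_diff : ∃ c : ENNReal, c ≠ 0 ∧ c ≠ ⊤ ∧
    Measure.map (fun p : ℝ × ℝ => (p.1 + p.2, p.1 - p.2)) (volume.prod volume) =
      c • ((volume : Measure ℝ).prod (volume : Measure ℝ)) := by
  let e : (ℝ × ℝ) ≃ₗ[ℝ] (ℝ × ℝ) :=
    { toFun := fun p => (p.1 + p.2, p.1 - p.2)
      invFun := fun p => ((p.1 + p.2) / 2, (p.1 - p.2) / 2)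
      map_add' := by intro p q; ext <;> simp <;> ring
      map_smul' := by intro p q; ext <;> simp <;> ring
      left_inv := by intro p; ext <;> simp
      right_inv := by intro p; ext <;> simp <;> ring }
  have hdet : LinearMap.det (e : (ℝ × ℝ) →ₗ[ℝ] (ℝ × ℝ)) ≠ 0 := (LinearEquiv.isUnit_det' e).ne_zero
  refine ⟨_, ?_, ?_, Measure.map_linearMap_addHaar_eq_smul_addHaar
    (volume.prod volume) hdet⟩
  · simp only [ne_eq, ENNReal.ofReal_eq_zero, not_le]
    exact abs_pos.2 (inv_ne_zero hdet)
  · exact ENNReal.ofReal_ne_top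

theorem measurable_sum_diff : Measurable (fun p : ℝ × ℝ => (p.1 + p.2, p.1 - p.2)) := by
  fun_prop

set_option maxHeartbeats 1000000 in
theorem re_integral_prod_nonneg {k : ℝ} {g : ℝ → ENNReal} (hg : Measurable g)
    (hgtop : ∀ t, g t ≠ ⊤)
    (hH : ∀ a, ∃ H : Measure ℝ, SFinite H ∧ ∀ᵐ b, g (a + b) * g (a - b) =
      ∫⁻ lam in Set.Ioi (2 * cosh b), ENNReal.ofReal ((lam - 2 * cosh b) ^ (k - 1)) ∂H)
    {K : ℝ × ℝ → ℂ} (hK : Measurable K)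
    (hint : Integrable K ((volume.withDensity g).prod (volume.withDensity g)))
    (hpos : ∀ a c, 0 < c → 0 ≤ (∫ b in Set.Ioo (-c) c,
      K (a + b, a - b) * (((2 * cosh c - 2 * cosh b) ^ (k - 1) : ℝ) : ℂ)).re) :
    0 ≤ (∫ p, K p ∂((volume.withDensity g).prod (volume.withDensity g))).re ∧
      ((∀ a c, 0 < c → 0 < (∫ b in Set.Ioo (-c) c,
        K (a + b, a - b) * (((2 * cosh c - 2 * cosh b) ^ (k - 1) : ℝ) : ℂ)).re) →
      ∫⁻ t, g t ≠ 0 →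
      0 < (∫ p, K p ∂((volume.withDensity g).prod (volume.withDensity g))).re) := by
  obtain ⟨c, hc0, hct, hmap⟩ := exists_map_sum_diff
  have hGm : Measurable (fun p : ℝ × ℝ => g p.1 * g p.2) := by fun_prop
  have hGt : ∀ p : ℝ × ℝ, g p.1 * g p.2 < ⊤ := fun p => ENNReal.mul_lt_top
    (hgtop _).lt_top (hgtop _).lt_top
  rw [prod_withDensity hg hg] at hint ⊢
  rw [integrable_withDensity_iff_integrable_smul' hGm (Filter.Eventually.of_forall hGt)] at hint
  rw [integral_withDensity_eq_integral_toReal_smul hGm (Filter.Eventually.of_forall hGt)]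
  set F : ℝ × ℝ → ℂ := fun p => (g p.1 * g p.2).toReal • K p with hFdef
  have hFm : Measurable F := hGm.ennreal_toReal.smul hK
  have hFi : Integrable (fun p : ℝ × ℝ => F (p.1 + p.2, p.1 - p.2)) (volume.prod volume) := by
    have : Integrable F (Measure.map (fun p : ℝ × ℝ => (p.1 + p.2, p.1 - p.2))
        (volume.prod volume)) := by
      rw [hmap]
      exact hint.smul_measure hct
    exact this.comp_measurable measurable_sum_diff
  have hFint : ∫ a, (∫ b, F (a + b, a - b)) = c.toReal • ∫ p, F p ∂(volume.prod volume) := by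
    rw [← integral_smul_measure, ← hmap, integral_map measurable_sum_diff.aemeasurable
      hFm.aestronglyMeasurable, integral_prod _ hFi]
  have hae : ∀ᵐ a, Integrable (fun b => F (a + b, a - b)) := hFi.prod_right_ae
  have hJi : Integrable (fun a => ∫ b, F (a + b, a - b)) := hFi.integral_prod_left
  have hre : (∫ a, (∫ b, F (a + b, a - b))).re = ∫ a, (∫ b, F (a + b, a - b)).re :=
    (integral_re hJi).symm
  have hcpos : 0 < c.toReal := ENNReal.toReal_pos hc0 hct
  have hfix : ∀ a, Integrable (fun b => F (a + b, a - b)) →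
      0 ≤ (∫ b, F (a + b, a - b)).re ∧
      ((∀ c, 0 < c → 0 < (∫ b in Set.Ioo (-c) c,
        K (a + b, a - b) * (((2 * cosh c - 2 * cosh b) ^ (k - 1) : ℝ) : ℂ)).re) →
      (∫ b, F (a + b, a - b)).re = 0 → ∀ᵐ b, g (a + b) * g (a - b) = 0) := by
    intro a ha
    obtain ⟨H, hHs, hHq⟩ := hH a
    exact re_integral_mixture_nonneg (q := fun b => g (a + b) * g (a - b))
      (κ := fun b => K (a + b, a - b)) hHq (fun b => (hGt (a + b, a - b)).ne)
      (hK.comp (by fun_prop)) ha (hpos a)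
  have hnn : 0 ≤ᵐ[volume] fun a => (∫ b, F (a + b, a - b)).re := by
    filter_upwards [hae] with a ha using (hfix a ha).1
  have hscale : (∫ a, (∫ b, F (a + b, a - b))).re =
      c.toReal * (∫ p, F p ∂(volume.prod volume)).re := by
    rw [hFint]; simp
  have hge : 0 ≤ (∫ p, F p ∂(volume.prod volume)).re := by
    have h1 : 0 ≤ (∫ a, (∫ b, F (a + b, a - b))).re := by
      rw [hre]; exact integral_nonneg_of_ae hnn
    rw [hscale] at h1
    exact nonneg_of_mul_nonneg_right h1 hcpos
  refine ⟨hge, fun hst hg0 => lt_of_le_of_ne hge fun h0 => hg0 ?_⟩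
  rw [← h0, mul_zero, hre, integral_eq_zero_iff_of_nonneg_ae hnn hJi.re] at hscale
  have hz : ∫⁻ a, ∫⁻ b, g (a + b) * g (a - b) = 0 := by
    rw [lintegral_eq_zero_iff' (by fun_prop)]
    filter_upwards [hscale, hae] with a ha hai
    rw [Pi.zero_apply, lintegral_eq_zero_iff (by fun_prop)]
    exact (hfix a hai).2 (hst a) ha
  have hz2 : ∫⁻ p : ℝ × ℝ, g p.1 * g p.2 ∂(Measure.map
      (fun p : ℝ × ℝ => (p.1 + p.2, p.1 - p.2)) (volume.prod volume)) = 0 := by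
    rw [lintegral_map hGm measurable_sum_diff, lintegral_prod _ (by fun_prop)]
    exact hz
  rw [hmap, lintegral_smul_measure, smul_eq_mul, mul_eq_zero, or_iff_right hc0,
    lintegral_prod_mul hg.aemeasurable hg.aemeasurable, mul_self_eq_zero] at hz2
  exact hz2

theorem one_add_mul_exp_mem_slitPlane {s : ℂ} (hs : s ∈ Complex.slitPlane) (t : ℝ) :
    1 + s * exp t ∈ Complex.slitPlane := by
  have ht := exp_pos t
  rw [Complex.mem_slitPlane_iff] at hs ⊢
  simp only [Complex.add_re, Complex.one_re, Complex.mul_re, Complex.ofReal_re, Complex.ofReal_im,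
    mul_zero, sub_zero, Complex.add_im, Complex.one_im, Complex.mul_im, zero_add]
  rcases hs with h | h
  · left; positivity
  · right; simp [h]

theorem exists_norm_one_add_mul_ge {s : ℂ} (hs : s ∈ Complex.slitPlane) :
    ∃ ε > 0, ∃ m > 0, ∀ z ∈ Metric.ball s ε, z ∈ Complex.slitPlane ∧
      ∀ x : ℝ, 0 ≤ x → m * (1 + x) ≤ ‖1 + z * x‖ := by
  obtain ⟨ε, hε, hsub⟩ := Metric.isOpen_iff.1 Complex.isOpen_slitPlane s hs
  have hsub2 : Metric.closedBall s (ε / 2) ⊆ Complex.slitPlane :=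
    (Metric.closedBall_subset_ball (by linarith)).trans hsub
  have hcomp : IsCompact (Metric.closedBall s (ε / 2) ×ˢ Set.Icc (0 : ℝ) 1) :=
    (isCompact_closedBall _ _).prod isCompact_Icc
  obtain ⟨p, hp, hmin⟩ := hcomp.exists_isMinOn
    ⟨(s, 0), Metric.mem_closedBall_self (by linarith), by simp⟩
    (f := fun p : ℂ × ℝ => ‖(1 - (p.2 : ℂ)) + p.1 * p.2‖) (by fun_prop)
  have hpos : ∀ q ∈ Metric.closedBall s (ε / 2) ×ˢ Set.Icc (0 : ℝ) 1,
      0 < ‖(1 - (q.2 : ℂ)) + q.1 * q.2‖ := by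
    rintro ⟨z, θ⟩ ⟨hz, hθ⟩
    rw [norm_pos_iff]
    have h1 := hsub2 hz
    rw [Complex.mem_slitPlane_iff] at h1
    simp only [Set.mem_Icc] at hθ
    intro h0
    have hre := congrArg Complex.re h0
    have him := congrArg Complex.im h0
    simp at hre him
    rcases him with him | him
    · rcases h1 with h1 | h1
      · nlinarith [hθ.1, hθ.2, mul_nonneg hθ.1 h1.le]
      · exact h1 him
    · simp [him] at hre
  refine ⟨ε / 2, by linarith, _, hpos p hp, fun z hz => ⟨hsub2 (Metric.ball_subset_closedBall hz),
    fun x hx => ?_⟩⟩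
  have hx1 : 0 < 1 + x := by linarith
  have := hmin (show (z, x / (1 + x)) ∈ _ from ⟨Metric.ball_subset_closedBall hz,
    by positivity, by rw [div_le_one hx1]; linarith⟩)
  simp only [Set.mem_ofPred_eq] at this
  have h2 : ‖1 + z * x‖ = ‖(1 - ((x / (1 + x) : ℝ) : ℂ)) + z * (x / (1 + x) : ℝ)‖ * (1 + x) := by
    have h3 : ((1 + x : ℝ) : ℂ) ≠ 0 := by exact_mod_cast hx1.ne'
    have h4 : 1 + x = ‖((1 + x : ℝ) : ℂ)‖ := by
      rw [Complex.norm_real, Real.norm_of_nonneg hx1.le]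
    rw [show ∀ r : ℝ, r * (1 + x) = r * ‖((1 + x : ℝ) : ℂ)‖ from fun r => by rw [← h4], ← norm_mul]
    congr 1
    push_cast at h3 ⊢
    field_simp
    ring
  rw [h2]
  gcongr

theorem norm_one_add_cpow_le {k m : ℝ} (hk : 0 < k) (hm : 0 < m) {z : ℂ} {x : ℝ} (hx : 0 ≤ x)
    (h : m * (1 + x) ≤ ‖1 + z * x‖) : ‖(1 + z * x) ^ ((-k : ℝ) : ℂ)‖ ≤ m ^ (-k) := by
  rw [Complex.norm_cpow_real]
  refine Real.rpow_le_rpow_of_nonpos hm ?_ (by linarith)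
  nlinarith

theorem norm_div_one_add_le {m : ℝ} (hm : 0 < m) {z : ℂ} {x : ℝ} (hx : 0 ≤ x)
    (h : m * (1 + x) ≤ ‖1 + z * x‖) : ‖(x : ℂ) / (1 + z * x)‖ ≤ m⁻¹ := by
  rw [norm_div, Complex.norm_real, Real.norm_of_nonneg hx]
  rw [div_le_iff₀ (lt_of_lt_of_le (by positivity) h)]
  calc x ≤ m⁻¹ * (m * (1 + x)) := by rw [inv_mul_cancel_left₀ hm.ne']; linarith
    _ ≤ _ := by gcongr

section Transform

variable {k : ℝ} {ν : Measure ℝ} {s : ℂ}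

theorem integrable_one_add_cpow [IsFiniteMeasure ν] (hk : 0 < k) (hs : s ∈ Complex.slitPlane) :
    Integrable (fun t : ℝ => (1 + s * exp t) ^ ((-k : ℝ) : ℂ)) ν := by
  obtain ⟨ε, hε, m, hm, hb⟩ := exists_norm_one_add_mul_ge hs
  refine Integrable.of_bound (Measurable.aestronglyMeasurable (by fun_prop)) (m ^ (-k))
    (Filter.Eventually.of_forall fun t => ?_)
  exact norm_one_add_cpow_le hk hm (exp_pos t).le
    ((hb s (Metric.mem_ball_self hε)).2 _ (exp_pos t).le)

theorem integrable_one_add_cpow_mul_div [IsFiniteMeasure ν] (hk : 0 < k) (hs : s ∈ Complex.slitPlane) :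
    Integrable (fun t : ℝ => (1 + s * exp t) ^ ((-k : ℝ) : ℂ) *
      (exp t / (1 + s * exp t))) ν := by
  obtain ⟨ε, hε, m, hm, hb⟩ := exists_norm_one_add_mul_ge hs
  refine Integrable.of_bound (Measurable.aestronglyMeasurable (by fun_prop)) (m ^ (-k) * m⁻¹)
    (Filter.Eventually.of_forall fun t => ?_)
  have := (hb s (Metric.mem_ball_self hε)).2 _ (exp_pos t).le
  rw [norm_mul]
  exact mul_le_mul (norm_one_add_cpow_le hk hm (exp_pos t).le this)
    (norm_div_one_add_le hm (exp_pos t).le this) (norm_nonneg _) (by positivity)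

theorem hasDerivAt_integral_one_add_cpow [IsFiniteMeasure ν] (hk : 0 < k) (hs : s ∈ Complex.slitPlane) :
    HasDerivAt (fun s : ℂ => ∫ t : ℝ, (1 + s * exp t) ^ ((-k : ℝ) : ℂ) ∂ν)
      (-k * ∫ t : ℝ, (1 + s * exp t) ^ ((-k : ℝ) : ℂ) * (exp t / (1 + s * exp t)) ∂ν) s := by
  obtain ⟨ε, hε, m, hm, hb⟩ := exists_norm_one_add_mul_ge hs
  rw [← integral_const_mul]
  refine (hasDerivAt_integral_of_dominated_loc_of_deriv_le (Metric.ball_mem_nhds s hε)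
    (F := fun (s : ℂ) (t : ℝ) => (1 + s * exp t) ^ ((-k : ℝ) : ℂ))
    (F' := fun (s : ℂ) (t : ℝ) =>
      -k * ((1 + s * exp t) ^ ((-k : ℝ) : ℂ) * (exp t / (1 + s * exp t))))
    (bound := fun _ => ‖(-k : ℂ)‖ * (m ^ (-k) * m⁻¹))
    (Filter.Eventually.of_forall fun z => Measurable.aestronglyMeasurable (by fun_prop))
    (integrable_one_add_cpow hk hs)
    ((integrable_one_add_cpow_mul_div hk hs).const_mul _).aestronglyMeasurable
    (Filter.Eventually.of_forall fun t z hz => ?_) (integrable_const _)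
    (Filter.Eventually.of_forall fun t z hz => ?_)).2
  · have := (hb z hz).2 _ (exp_pos t).le
    rw [norm_mul, norm_mul]
    gcongr
    · exact norm_one_add_cpow_le hk hm (exp_pos t).le this
    · exact norm_div_one_add_le hm (exp_pos t).le this
  · have hz1 := one_add_mul_exp_mem_slitPlane (hb z hz).1 t
    have h1 : HasDerivAt (fun z : ℂ => 1 + z * exp t) (exp t : ℂ) z := by
      simpa using ((hasDerivAt_id z).mul_const (exp t : ℂ)).const_add 1
    have h2 := h1.cpow_const (c := ((-k : ℝ) : ℂ)) hz1
    convert! h2 using 1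
    rw [Complex.cpow_sub _ _ (Complex.slitPlane_ne_zero hz1), Complex.cpow_one]
    push_cast
    ring

theorem conj_integral_one_add_cpow (hs : s ∈ Complex.slitPlane) :
    ∫ t : ℝ, (1 + starRingEnd ℂ s * exp t) ^ ((-k : ℝ) : ℂ) ∂ν =
      starRingEnd ℂ (∫ t : ℝ, (1 + s * exp t) ^ ((-k : ℝ) : ℂ) ∂ν) := by
  rw [← integral_conj]
  congr 1
  ext t
  rw [← conj_cpow_ofReal (Complex.slitPlane_arg_ne_pi (one_add_mul_exp_mem_slitPlane hs t))]
  simp only [map_add, map_one, map_mul, Complex.conj_ofReal]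

theorem conj_integral_one_add_cpow_mul_div (hs : s ∈ Complex.slitPlane) :
    ∫ t : ℝ, (1 + starRingEnd ℂ s * exp t) ^ ((-k : ℝ) : ℂ) *
      (exp t / (1 + starRingEnd ℂ s * exp t)) ∂ν =
      starRingEnd ℂ (∫ t : ℝ, (1 + s * exp t) ^ ((-k : ℝ) : ℂ) *
        (exp t / (1 + s * exp t)) ∂ν) := by
  rw [← integral_conj]
  congr 1
  ext t
  rw [map_mul, ← conj_cpow_ofReal
    (Complex.slitPlane_arg_ne_pi (one_add_mul_exp_mem_slitPlane hs t))]
  simp only [map_add, map_one, map_mul, map_div₀, Complex.conj_ofReal]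

theorem ofReal_one_add_mul_exp_cpow {s : ℝ} (hs : 0 ≤ s) (t : ℝ) :
    (1 + (s : ℂ) * exp t) ^ ((-k : ℝ) : ℂ) = (((1 + s * exp t) ^ (-k) : ℝ) : ℂ) := by
  rw [Complex.ofReal_cpow (by positivity)]
  push_cast
  rfl

end Transform

theorem integral_one_add_cpow_ne_zero_and_im {k : ℝ} (hk : 0 < k) {g : ℝ → ENNReal}
    (hg : Measurable g) (hgtop : ∀ t, g t ≠ ⊤) (hg1 : ∫⁻ t, g t = 1)
    (hH : ∀ a, ∃ H : Measure ℝ, SFinite H ∧ ∀ᵐ b, g (a + b) * g (a - b) =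
      ∫⁻ lam in Set.Ioi (2 * cosh b), ENNReal.ofReal ((lam - 2 * cosh b) ^ (k - 1)) ∂H)
    {s : ℂ} (hs : 0 < s.im) :
    (∫ t : ℝ, (1 + s * exp t) ^ ((-k : ℝ) : ℂ) ∂(volume.withDensity g)) ≠ 0 ∧
    0 ≤ ((-k * ∫ t : ℝ, (1 + s * exp t) ^ ((-k : ℝ) : ℂ) * (exp t / (1 + s * exp t))
      ∂(volume.withDensity g)) /
      (∫ t : ℝ, (1 + s * exp t) ^ ((-k : ℝ) : ℂ) ∂(volume.withDensity g))).im := by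
  have hfin : IsFiniteMeasure (volume.withDensity g) :=
    isFiniteMeasure_withDensity (by rw [hg1]; exact ENNReal.one_ne_top)
  have hsl : s ∈ Complex.slitPlane := Complex.mem_slitPlane_iff.2 (Or.inr hs.ne')
  have hsl' : starRingEnd ℂ s ∈ Complex.slitPlane :=
    Complex.mem_slitPlane_iff.2 (Or.inr (by simpa using hs.ne'))
  have hshift : ∀ (z : ℂ) (a b : ℝ), 1 + z * exp (a + b) = 1 + (z * exp a) * exp b := by
    intro z a b
    rw [exp_add]
    push_cast
    ring
  have hima : ∀ a : ℝ, 0 < (s * exp a).im := by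
    intro a
    rw [Complex.im_mul_ofReal]
    exact mul_pos hs (exp_pos a)
  have hconj : ∀ a b : ℝ, 1 + starRingEnd ℂ s * exp (a - b) =
      1 + starRingEnd ℂ (s * exp a) * exp (-b) := by
    intro a b
    rw [sub_eq_add_neg, hshift, map_mul, Complex.conj_ofReal]
  set φ : ℂ := ∫ t : ℝ, (1 + s * exp t) ^ ((-k : ℝ) : ℂ) ∂(volume.withDensity g) with hφ
  set ψ : ℂ := ∫ t : ℝ, (1 + s * exp t) ^ ((-k : ℝ) : ℂ) * (exp t / (1 + s * exp t))
      ∂(volume.withDensity g) with hψ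
  have hi0 := integrable_one_add_cpow (ν := volume.withDensity g) hk hsl
  have hi0' := integrable_one_add_cpow (ν := volume.withDensity g) hk hsl'
  have hi1 := integrable_one_add_cpow_mul_div (ν := volume.withDensity g) hk hsl
  have h1 := (re_integral_prod_nonneg (k := k) hg hgtop hH
    (K := fun p => (1 + s * exp p.1) ^ ((-k : ℝ) : ℂ) *
      (1 + starRingEnd ℂ s * exp p.2) ^ ((-k : ℝ) : ℂ))
    (by fun_prop) (hi0.mul_prod hi0') (fun a c hc => by
      simp only [hshift s, hconj]
      exact (re_kernel_integral_pos (hima a) hc hk).le)).2 (fun a c hc => by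
      simp only [hshift s, hconj]
      exact re_kernel_integral_pos (hima a) hc hk) (by rw [hg1]; exact one_ne_zero)
  have h2 := (re_integral_prod_nonneg (k := k) hg hgtop hH
    (K := fun p => (Complex.I * ((1 + s * exp p.1) ^ ((-k : ℝ) : ℂ) *
      (exp p.1 / (1 + s * exp p.1)))) *
      (1 + starRingEnd ℂ s * exp p.2) ^ ((-k : ℝ) : ℂ))
    (by fun_prop) ((hi1.const_mul Complex.I).mul_prod hi0') (fun a c hc => by
      simp only [hshift s, hconj]
      have := im_kernel_integral_nonpos (hima a) hc hk
      have e : ∀ b : ℝ, Complex.I * ((1 + s * exp a * exp b) ^ ((-k : ℝ) : ℂ) *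
          (exp (a + b) / (1 + s * exp a * exp b))) *
          (1 + starRingEnd ℂ (s * exp a) * exp (-b)) ^ ((-k : ℝ) : ℂ) *
          (((2 * cosh c - 2 * cosh b) ^ (k - 1) : ℝ) : ℂ) =
          Complex.I * exp a * ((1 + s * exp a * exp b) ^ ((-k : ℝ) : ℂ) *
          (1 + starRingEnd ℂ (s * exp a) * exp (-b)) ^ ((-k : ℝ) : ℂ) *
          (((2 * cosh c - 2 * cosh b) ^ (k - 1) : ℝ) : ℂ) *
          (exp b / (1 + s * exp a * exp b))) := by
        intro b
        rw [exp_add]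
        push_cast
        ring
      simp only [e]
      rw [integral_const_mul, mul_comm Complex.I, mul_assoc, Complex.re_ofReal_mul,
        Complex.I_mul_re]
      exact mul_nonneg (exp_pos a).le (by linarith))).1
  rw [integral_prod_mul (fun t : ℝ => (1 + s * exp t) ^ ((-k : ℝ) : ℂ))
    (fun t : ℝ => (1 + starRingEnd ℂ s * exp t) ^ ((-k : ℝ) : ℂ)), ← hφ, conj_integral_one_add_cpow hsl, ← hφ, Complex.mul_conj,
    Complex.ofReal_re] at h1
  rw [integral_prod_mul (fun t : ℝ => Complex.I * ((1 + s * exp t) ^ ((-k : ℝ) : ℂ) *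
      (exp t / (1 + s * exp t))))
    (fun t : ℝ => (1 + starRingEnd ℂ s * exp t) ^ ((-k : ℝ) : ℂ)), integral_const_mul, ← hψ, conj_integral_one_add_cpow hsl, ← hφ,
    mul_assoc, Complex.I_mul_re] at h2
  refine ⟨fun h => by simp [h] at h1, ?_⟩
  have e3 : (-k * ψ) / φ =
      ((k / Complex.normSq φ : ℝ) : ℂ) * (-(ψ * starRingEnd ℂ φ)) := by
    rw [div_eq_mul_inv, Complex.inv_def]
    push_cast
    ring
  rw [e3, Complex.im_ofReal_mul, Complex.neg_im]
  exact mul_nonneg (div_nonneg hk.le h1.le) h2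

theorem cayley_sq_mem_slitPlane {z : ℂ} (hz : z ∈ Metric.ball (0 : ℂ) 1) :
    ((1 + z) / (1 - z)) ^ 2 ∈ Complex.slitPlane ∧
      ∃ r : ℝ, 0 < r ∧ (((1 + z) / (1 - z)) ^ 2).im = r * z.im := by
  have hn : Complex.normSq z < 1 := by
    rw [Complex.normSq_eq_norm_sq]
    have : ‖z‖ < 1 := by simpa using hz
    nlinarith [norm_nonneg z]
  have h1 : 1 - z ≠ 0 := by
    intro h
    have : z = 1 := (sub_eq_zero.1 h).symm
    simp [this] at hn
  have hd : 0 < Complex.normSq (1 - z) := Complex.normSq_pos.2 h1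
  have hw : (1 + z) / (1 - z) = ((1 / Complex.normSq (1 - z) : ℝ) : ℂ) *
      ((1 + z) * starRingEnd ℂ (1 - z)) := by
    rw [div_eq_mul_inv, Complex.inv_def]
    push_cast
    ring
  have hre : ((1 + z) / (1 - z)).re = 1 / Complex.normSq (1 - z) * (1 - Complex.normSq z) := by
    rw [hw, Complex.re_ofReal_mul]
    congr 1
    simp [Complex.normSq_apply]
    ring
  have him : ((1 + z) / (1 - z)).im = 1 / Complex.normSq (1 - z) * (2 * z.im) := by
    rw [hw, Complex.im_ofReal_mul]
    congr 1
    simp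
    ring
  have hrep : 0 < ((1 + z) / (1 - z)).re := by
    rw [hre]
    exact mul_pos (by positivity) (by linarith)
  set w := (1 + z) / (1 - z)
  have him2 : (w ^ 2).im = 2 * w.re * w.im := by
    rw [sq, Complex.mul_im]
    ring
  refine ⟨?_, 2 * w.re * (1 / Complex.normSq (1 - z) * 2), by positivity, ?_⟩
  · rw [Complex.mem_slitPlane_iff]
    rcases eq_or_ne w.im 0 with h0 | h0
    · left
      rw [sq, Complex.mul_re, h0]
      nlinarith
    · right
      rw [him2]
      exact mul_ne_zero (by positivity) h0
  · rw [him2, him]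
    ring

theorem two_mul_div_eq_of_sqrt {s : ℝ} (hs : 0 < s) (c : ℝ) :
    2 * ((√s - 1) / (√s + 1)) / (1 - 2 * ((√s - 1) / (√s + 1)) * c +
      ((√s - 1) / (√s + 1)) ^ 2) = (s - 1) / ((1 + c) + s * (1 - c)) := by
  have hr : 0 < √s := Real.sqrt_pos.2 hs
  have hsq : √s ^ 2 = s := Real.sq_sqrt hs.le
  generalize √s = r at hr hsq
  subst hsq
  have hr1 : r + 1 ≠ 0 := by positivity
  rw [show 2 * ((r - 1) / (r + 1)) = (2 / (r + 1) ^ 2) * (r ^ 2 - 1) by field_simp; ring,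
    show 1 - 2 / (r + 1) ^ 2 * (r ^ 2 - 1) * c + ((r - 1) / (r + 1)) ^ 2 =
      (2 / (r + 1) ^ 2) * ((1 + c) + r ^ 2 * (1 - c)) by field_simp; ring]
  exact mul_div_mul_left _ _ (by positivity)

set_option maxHeartbeats 1000000 in
theorem exists_thorin_of_logDensity {k : ℝ} (hk : 0 < k) {g : ℝ → ENNReal}
    (hg : Measurable g) (hgtop : ∀ t, g t ≠ ⊤) (hg1 : ∫⁻ t, g t = 1)
    (hH : ∀ a, ∃ H : Measure ℝ, SFinite H ∧ ∀ᵐ b, g (a + b) * g (a - b) =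
      ∫⁻ lam in Set.Ioi (2 * cosh b), ENNReal.ofReal ((lam - 2 * cosh b) ^ (k - 1)) ∂H) :
    ∃ (a : ℝ) (U : Measure ℝ),
      0 ≤ a ∧ U (Set.Iic 0) = 0 ∧
      (∀ r s : ℝ, 0 < r → U (Set.Icc r s) < ⊤) ∧
      (∫⁻ t in Set.Ioc (0:ℝ) 1, ENNReal.ofReal |Real.log t| ∂U) < ⊤ ∧
      (∫⁻ t in Set.Ici (1:ℝ), ENNReal.ofReal t⁻¹ ∂U) < ⊤ ∧
      ∀ s : ℝ, 0 ≤ s →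
        (∫ t, (1 + s * exp t) ^ (-k) ∂(volume.withDensity g)) =
          Real.exp (-(a * s) + ∫ t in Set.Ioi (0:ℝ), Real.log (t / (t + s)) ∂U) := by
  have hprob : IsProbabilityMeasure (volume.withDensity g) :=
    ⟨by rw [withDensity_apply _ MeasurableSet.univ, setLIntegral_univ, hg1]⟩
  set ν := volume.withDensity g with hν
  set φ : ℂ → ℂ := fun s => ∫ t : ℝ, (1 + s * exp t) ^ ((-k : ℝ) : ℂ) ∂ν with hφ
  set ψ : ℂ → ℂ := fun s => ∫ t : ℝ, (1 + s * exp t) ^ ((-k : ℝ) : ℂ) *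
    (exp t / (1 + s * exp t)) ∂ν with hψ
  have hderiv : ∀ s ∈ Complex.slitPlane, HasDerivAt φ (-k * ψ s) s := fun s hs =>
    hasDerivAt_integral_one_add_cpow hk hs
  have hφreal : ∀ s : ℝ, 0 ≤ s → φ s = ((∫ t, (1 + s * exp t) ^ (-k) ∂ν : ℝ) : ℂ) := by
    intro s hs
    rw [← integral_complex_ofReal]
    exact integral_congr_ae (Filter.Eventually.of_forall (ofReal_one_add_mul_exp_cpow hs))
  have hle1 : ∀ s : ℝ, 0 ≤ s → ∀ t, ‖(1 + s * exp t) ^ (-k)‖ ≤ 1 := by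
    intro s hs t
    have : 0 ≤ s * exp t := by positivity
    rw [Real.norm_of_nonneg (by positivity)]
    exact Real.rpow_le_one_of_one_le_of_nonpos (by linarith) (by linarith)
  have hLi : ∀ s : ℝ, 0 ≤ s → Integrable (fun t => (1 + s * exp t) ^ (-k)) ν := fun s hs =>
    Integrable.of_bound (Measurable.aestronglyMeasurable (by fun_prop)) 1
      (Filter.Eventually.of_forall (hle1 s hs))
  have hLpos : ∀ s : ℝ, 0 ≤ s → 0 < ∫ t, (1 + s * exp t) ^ (-k) ∂ν := by
    intro s hs
    rw [integral_pos_iff_support_of_nonneg (fun t => by positivity) (hLi s hs)]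
    have : Function.support (fun t => (1 + s * exp t) ^ (-k)) = Set.univ := by
      ext t
      have : 0 < (1 + s * exp t) ^ (-k) := by positivity
      simp [this.ne']
    rw [this]
    simp
  have hLre : ∀ s : ℝ, 0 ≤ s → (φ s).re = ∫ t, (1 + s * exp t) ^ (-k) ∂ν := by
    intro s hs
    rw [hφreal s hs, Complex.ofReal_re]
  have hconjφ : ∀ s ∈ Complex.slitPlane, φ (starRingEnd ℂ s) = starRingEnd ℂ (φ s) :=
    fun s hs => conj_integral_one_add_cpow hs
  have hconjψ : ∀ s ∈ Complex.slitPlane, ψ (starRingEnd ℂ s) = starRingEnd ℂ (ψ s) :=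
    fun s hs => conj_integral_one_add_cpow_mul_div hs
  have hup : ∀ s : ℂ, 0 < s.im → φ s ≠ 0 ∧ 0 ≤ (-k * ψ s / φ s).im := fun s hs =>
    integral_one_add_cpow_ne_zero_and_im hk hg hgtop hg1 hH hs
  have hdown : ∀ s : ℂ, s.im < 0 → φ s ≠ 0 ∧ (-k * ψ s / φ s).im ≤ 0 := by
    intro s hs
    have hsl : s ∈ Complex.slitPlane := Complex.mem_slitPlane_iff.2 (Or.inr hs.ne)
    obtain ⟨h1, h2⟩ := hup (starRingEnd ℂ s) (by simpa using hs)
    rw [hconjφ s hsl] at h1 h2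
    rw [hconjψ s hsl] at h2
    have e : -k * starRingEnd ℂ (ψ s) / starRingEnd ℂ (φ s) =
        starRingEnd ℂ (-k * ψ s / φ s) := by
      simp
    rw [e, Complex.conj_im] at h2
    exact ⟨fun h => h1 (by simp [h]), by linarith⟩
  have hne : ∀ s ∈ Complex.slitPlane, φ s ≠ 0 := by
    intro s hs
    rcases lt_trichotomy s.im 0 with h | h | h
    · exact (hdown s h).1
    · have hre : 0 < s.re := by
        rw [Complex.mem_slitPlane_iff] at hs
        exact hs.resolve_right (by simp [h])
      have e : s = ((s.re : ℝ) : ℂ) := Complex.ext rfl (by simp [h])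
      rw [e, hφreal _ hre.le]
      exact_mod_cast (hLpos _ hre.le).ne'
    · exact (hup s h).1
  have hφd : DifferentiableOn ℂ φ Complex.slitPlane := fun s hs =>
    (hderiv s hs).differentiableAt.differentiableWithinAt
  have hΦd : DifferentiableOn ℂ (fun s => -k * ψ s / φ s) Complex.slitPlane := by
    have h1 : DifferentiableOn ℂ (fun s => -k * ψ s) Complex.slitPlane :=
      (hφd.deriv Complex.isOpen_slitPlane).congr fun s hs => (hderiv s hs).deriv.symm
    exact h1.div hφd hne
  obtain ⟨μ, hμf, hμ, hrep⟩ := exists_measure_of_im_mul_im_nonneg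
    (p := fun z => -k * ψ (((1 + z) / (1 - z)) ^ 2) / φ (((1 + z) / (1 - z)) ^ 2))
    (by
      refine hΦd.comp (t := Complex.slitPlane)
        (f := fun z : ℂ => ((1 + z) / (1 - z)) ^ 2) ?_ fun z hz => (cayley_sq_mem_slitPlane hz).1
      have : ∀ z ∈ Metric.ball (0 : ℂ) 1, 1 - z ≠ 0 := by
        intro z hz h
        have : z = 1 := (sub_eq_zero.1 h).symm
        simp [this] at hz
      exact (DifferentiableOn.div (by fun_prop) (by fun_prop) this).pow 2)
    (by
      intro z hz
      obtain ⟨-, r, hr, him⟩ := cayley_sq_mem_slitPlane hz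
      rcases lt_trichotomy z.im 0 with h | h | h
      · exact mul_nonneg_of_nonpos_of_nonpos h.le
          (hdown _ (by rw [him]; exact mul_neg_of_pos_of_neg hr h)).2
      · simp [h]
      · exact mul_nonneg h.le (hup _ (by rw [him]; exact mul_pos hr h)).2)
  set h : ℝ → ℝ := fun s => -(-k * ψ s / φ s).re with hh
  have hψreal : ∀ s : ℝ, 0 < s → ψ s =
      ((∫ t, (1 + s * exp t) ^ (-k) * (exp t / (1 + s * exp t)) ∂ν : ℝ) : ℂ) := by
    intro s hs
    rw [← integral_complex_ofReal]
    refine integral_congr_ae (Filter.Eventually.of_forall fun t => ?_)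
    simp only [Complex.ofReal_mul, ← ofReal_one_add_mul_exp_cpow hs.le t]
    push_cast
    rfl
  have hhpos : ∀ s, 0 < s → 0 ≤ h s := by
    intro s hs
    simp only [hh]
    rw [hψreal s hs, hφreal s hs.le, ← Complex.ofReal_neg, ← Complex.ofReal_mul,
      ← Complex.ofReal_div, Complex.ofReal_re, neg_mul, neg_div, neg_neg]
    refine div_nonneg (mul_nonneg hk.le (integral_nonneg fun t => ?_)) (hLpos s hs.le).le
    positivity
  have hhrep : ∀ s, 0 < s → h s = h 1 - ∫ c, (s - 1) / ((1 + c) + s * (1 - c)) ∂μ := by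
    intro s hs
    have hr : 0 < √s := Real.sqrt_pos.2 hs
    have hζ : |(√s - 1) / (√s + 1)| < 1 := by
      rw [abs_div, abs_of_pos (by linarith : 0 < √s + 1), div_lt_one (by linarith), abs_lt]
      constructor <;> linarith
    have := hrep _ hζ
    simp only [two_mul_div_eq_of_sqrt hs] at this
    have e : ((1 + (((√s - 1) / (√s + 1) : ℝ) : ℂ)) / (1 - (((√s - 1) / (√s + 1) : ℝ) : ℂ))) ^ 2
        = (s : ℂ) := by
      have e1 : (1 + (√s - 1) / (√s + 1)) / (1 - (√s - 1) / (√s + 1)) = √s := by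
        have : √s + 1 ≠ 0 := by positivity
        rw [show 1 + (√s - 1) / (√s + 1) = 2 / (√s + 1) * √s by field_simp; ring,
          show 1 - (√s - 1) / (√s + 1) = 2 / (√s + 1) by field_simp; ring]
        field_simp
      rw [← Complex.ofReal_one, ← Complex.ofReal_add, ← Complex.ofReal_sub,
        ← Complex.ofReal_div, e1, ← Complex.ofReal_pow, Real.sq_sqrt hs.le]
    rw [e] at this
    simp only [hh, this]
    simp
    ring
  obtain ⟨a, V, ha, hVs, hV0, hV⟩ := exists_stieltjes_measure hhpos hμ hhrep
  obtain ⟨U, hU1, hU2, hU3, hU4, hU5⟩ := exists_thorin_measure (L := fun s => (φ s).re) (h := h)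
    (by simp only [hLre 0 le_rfl]; simp)
    (fun s hs => by rw [hLre s hs]; exact hLpos s hs)
    (by
      refine ContinuousOn.congr (f := fun s => ∫ t, (1 + s * exp t) ^ (-k) ∂ν) ?_
        (fun s hs => hLre s hs)
      refine continuousOn_of_dominated (bound := fun _ => 1)
        (fun s _ => Measurable.aestronglyMeasurable (by fun_prop))
        (fun s hs => Filter.Eventually.of_forall (hle1 s hs)) (integrable_const _)
        (Filter.Eventually.of_forall fun t => ?_)
      refine ContinuousOn.rpow_const (by fun_prop) fun s hs => Or.inl ?_
      have : 0 ≤ s * exp t := mul_nonneg hs (exp_pos t).le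
      linarith)
    (fun s hs => by
      have hsl : (s : ℂ) ∈ Complex.slitPlane := Complex.mem_slitPlane_iff.2 (Or.inl (by simpa))
      have h1 := (hderiv s hsl).real_of_complex
      convert! h1 using 1
      have e : -k * ψ s = (-k * ψ s / φ s) * ((φ s).re : ℝ) := by
        rw [hLre s hs.le, ← hφreal s hs.le, div_mul_cancel₀ _ (hne _ hsl)]
      rw [e, Complex.re_mul_ofReal]
      simp [hh])
    hhpos ha hV0 hV
  exact ⟨a, U, ha, hU1, hU2, hU3, hU4, fun s hs => by rw [← hLre s hs]; exact hU5 s hs⟩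

theorem exists_maximal_measurable_le {α : Type*} [MeasurableSpace α] {m : Measure α}
    {F : α → ENNReal} (hF : ∫⁻ t, F t ∂m ≠ ⊤) :
    ∃ g, Measurable g ∧ g ≤ F ∧ ∫⁻ t, F t ∂m = ∫⁻ t, g t ∂m ∧
      ∀ h, Measurable h → h ≤ F → h ≤ᵐ[m] g := by
  obtain ⟨g, hg, hgF, hint⟩ := exists_measurable_le_lintegral_eq m F
  refine ⟨g, hg, hgF, hint, fun h hh hhF => ?_⟩
  have hmax : g =ᵐ[m] fun t => max (h t) (g t) :=
    ae_eq_of_ae_le_of_lintegral_le (Filter.Eventually.of_forall fun t => le_max_right _ _)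
      (hint ▸ hF) (hh.max hg).aemeasurable
      (hint ▸ lintegral_mono fun t => max_le (hhF t) (hgF t))
  filter_upwards [hmax] with t ht
  rw [ht]
  exact le_max_left _ _

theorem exists_minimal_measurable_ge {α : Type*} [MeasurableSpace α] (m : Measure α) [SFinite m]
    (F : α → ENNReal) : ∃ G, Measurable G ∧ F ≤ G ∧
      ∀ h, Measurable h → F ≤ h → G ≤ᵐ[m] h := by
  have hle : ∀ x : ENNReal, (1 + x)⁻¹ ≤ 1 := fun x => ENNReal.inv_le_one.2 le_self_add
  have hfin : ∫⁻ t, (1 + F t)⁻¹ ∂m.toFinite ≠ ⊤ := by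
    refine ne_top_of_le_ne_top (measure_ne_top m.toFinite Set.univ) ?_
    calc ∫⁻ t, (1 + F t)⁻¹ ∂m.toFinite ≤ ∫⁻ t, 1 ∂m.toFinite := lintegral_mono fun t => hle _
      _ = _ := lintegral_one
  obtain ⟨j, hj, hjF, -, hmax⟩ := exists_maximal_measurable_le hfin
  refine ⟨fun t => (j t)⁻¹ - 1, hj.inv.sub_const 1, fun t => ?_, fun h hh hFh => ?_⟩
  · refine ENNReal.le_sub_of_add_le_left ENNReal.one_ne_top ?_
    exact ENNReal.le_inv_iff_le_inv.1 (hjF t)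
  · have h1 := hmax (fun t => (1 + h t)⁻¹) (by fun_prop)
      (fun t => ENNReal.inv_le_inv.2 (add_le_add_right (hFh t) _))
    filter_upwards [(absolutelyContinuous_toFinite m).ae_le h1] with t ht
    rw [tsub_le_iff_left]
    exact ENNReal.inv_le_iff_inv_le.1 ht

set_option maxHeartbeats 400000 in
/-- If all the products `x ↦ F x * F (c - x)` are measurable, then these products agree almost
everywhere, up to a constant factor, with those of a measurable minorant of `F`. -/
theorem exists_measurable_mul_reflect_eq {F : ℝ → ENNReal} (htop : ∀ t, F t ≠ ⊤)
    (hF : ∫⁻ t, F t = 1) (hmeas : ∀ c, Measurable fun x => F x * F (c - x)) :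
    ∃ g : ℝ → ENNReal, Measurable g ∧ g ≤ F ∧ ∫⁻ t, g t = 1 ∧
      ∃ C : ENNReal, ∀ c, ∀ᵐ x, g x * g (c - x) = C * (F x * F (c - x)) := by
  obtain ⟨g, hg, hgF, hgint, hgmax⟩ := exists_maximal_measurable_le (m := volume)
    (hF ▸ ENNReal.one_ne_top)
  rw [hF] at hgint
  obtain ⟨G, hG, hFG, hGmin⟩ := exists_minimal_measurable_ge volume F
  have hgtop : ∀ t, g t ≠ ⊤ := fun t => ne_top_of_le_ne_top (htop t) (hgF t)
  have hrefl : ∀ (c : ℝ) {p : ℝ → Prop}, (∀ᵐ x, p x) → ∀ᵐ x, p (c - x) := fun c p hp =>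
    (Measure.measurePreserving_sub_left volume c).quasiMeasurePreserving.ae hp
  have hupper : ∀ c, ∀ᵐ x, F x * F (c - x) ≠ 0 → G x ≠ ⊤ → F x * F (c - x) ≤ G x * g (c - x) := by
    intro c
    have h1 := hgmax (fun y => (F y * F (c - y)) / G (c - y))
      ((hmeas c).div (hG.comp (by fun_prop))) (fun y => by
        refine ENNReal.div_le_of_le_mul ?_
        gcongr
        exact hFG _)
    filter_upwards [hrefl c h1] with x hx h0 hGx
    simp only [sub_sub_cancel] at hx
    have hG0 : G x ≠ 0 := fun h => h0 (by
      have := hFG x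
      rw [h, nonpos_iff_eq_zero] at this
      simp [this])
    rw [ENNReal.div_le_iff hG0 hGx, mul_comm (F (c - x))] at hx
    rwa [mul_comm (G x)]
  have hlower : ∀ c, ∀ᵐ x, G x * g (c - x) ≤ F x * F (c - x) := by
    intro c
    have hm : Measurable fun x => g (c - x) := hg.comp (by fun_prop)
    have h1 := hGmin (fun x => if g (c - x) = 0 then ⊤ else (F x * F (c - x)) / g (c - x))
      (Measurable.ite (hm (measurableSet_singleton 0)) measurable_const ((hmeas c).div hm))
      (fun x => by
        dsimp only
        split_ifs with h
        · exact le_top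
        · rw [ENNReal.le_div_iff_mul_le (Or.inl h) (Or.inl (hgtop _))]
          gcongr
          exact hgF _)
    filter_upwards [h1] with x hx
    split_ifs at hx with h
    · simp [h]
    · exact (ENNReal.le_div_iff_mul_le (Or.inl h) (Or.inl (hgtop _))).1 hx
  have hgne : ¬ ∀ᵐ x, g x = 0 := by
    intro h
    rw [lintegral_congr_ae h] at hgint
    simp at hgint
  have hGtop : ∀ᵐ x, G x ≠ ⊤ := by
    have h1 : ∀ c : ℝ, ∀ᵐ x, G x = ⊤ → g (c - x) = 0 := by
      intro c
      filter_upwards [hlower c] with x hx hGx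
      by_contra h
      rw [hGx, ENNReal.top_mul h, top_le_iff] at hx
      exact ENNReal.mul_ne_top (htop _) (htop _) hx
    have h2 := (Measure.ae_ae_comm (μ := volume) (ν := volume) (p := fun c x : ℝ => G x = ⊤ → g (c - x) = 0) (by
      have : {p : ℝ × ℝ | G p.2 = ⊤ → g (p.1 - p.2) = 0} =
          {p : ℝ × ℝ | G p.2 = ⊤}ᶜ ∪ {p : ℝ × ℝ | g (p.1 - p.2) = 0} := by
        ext p
        simp [imp_iff_not_or]
      rw [this]
      exact ((hG.comp measurable_snd) (measurableSet_singleton ⊤)).compl.union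
        ((hg.comp (by fun_prop : Measurable fun p : ℝ × ℝ => p.1 - p.2))
          (measurableSet_singleton 0)))).1 (Filter.Eventually.of_forall h1)
    filter_upwards [h2] with x hx hGx
    refine hgne ?_
    have h3 : ∀ᵐ c : ℝ, g (c - x) = 0 := hx.mono fun c hc => hc hGx
    have h4 := (measurePreserving_add_right volume x).quasiMeasurePreserving.ae h3
    simpa using h4
  have heq : ∀ c, ∀ᵐ x, F x * F (c - x) = G x * g (c - x) := by
    intro c
    filter_upwards [hupper c, hlower c, hGtop] with x h1 h2 h3
    rcases eq_or_ne (F x * F (c - x)) 0 with h0 | h0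
    · rw [h0] at h2 ⊢
      exact (nonpos_iff_eq_zero.1 h2).symm
    · exact le_antisymm (h1 h0 h3) h2
  have hcross : ∀ᵐ x, ∀ᵐ y, G x * g y = G y * g x := by
    have h1 : ∀ c : ℝ, ∀ᵐ x, G x * g (c - x) = G (c - x) * g x := by
      intro c
      filter_upwards [heq c, hrefl c (heq c)] with x h1 h2
      rw [sub_sub_cancel] at h2
      rw [← h1, ← h2, mul_comm]
    have h2 := (Measure.ae_ae_comm (μ := volume) (ν := volume) (p := fun c x : ℝ => G x * g (c - x) = G (c - x) * g x) (by
      exact measurableSet_eq_fun (by fun_prop) (by fun_prop))).1 (Filter.Eventually.of_forall h1)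
    filter_upwards [h2] with x hx
    have h4 := (measurePreserving_add_right volume x).quasiMeasurePreserving.ae hx
    simpa using h4
  obtain ⟨x₀, hx₀, hcx, hGx⟩ : ∃ x, g x ≠ 0 ∧ (∀ᵐ y, G x * g y = G y * g x) ∧ G x ≠ ⊤ := by
    by_contra hcon
    push Not at hcon
    refine hgne ?_
    filter_upwards [hcross, hGtop] with x h1 h2
    by_contra h
    exact h2 (hcon x h h1)
  have hG0 : G x₀ ≠ 0 := fun h => hx₀ (by
    have := (hgF x₀).trans (hFG x₀)
    rwa [h, nonpos_iff_eq_zero] at this)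
  refine ⟨g, hg, hgF, hgint.symm, g x₀ / G x₀, fun c => ?_⟩
  filter_upwards [heq c, hcx] with x h1 h2
  rw [h1, ← mul_assoc]
  congr 1
  rw [ENNReal.div_eq_inv_mul, mul_assoc, mul_comm (g x₀), ← h2, ← mul_assoc,
    ENNReal.inv_mul_cancel hG0 hGx, one_mul]

theorem measurable_fractional_kernel (r : ℝ) :
    Measurable (fun p : ℝ × ℝ => (Set.Ioi p.1).indicator
      (fun lam => ENNReal.ofReal ((lam - p.1) ^ r)) p.2) := by
  have : (fun p : ℝ × ℝ => (Set.Ioi p.1).indicator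
      (fun lam => ENNReal.ofReal ((lam - p.1) ^ r)) p.2) =
      Set.indicator {p : ℝ × ℝ | p.1 < p.2} (fun p => ENNReal.ofReal ((p.2 - p.1) ^ r)) := by
    ext p
    simp [Set.indicator_apply]
  rw [this]
  refine Measurable.indicator ?_ (measurableSet_lt measurable_fst measurable_snd)
  fun_prop

theorem measurable_fractional_lintegral (H : Measure ℝ) [SFinite H] (r : ℝ) :
    Measurable (fun w => ∫⁻ lam in Set.Ioi w, ENNReal.ofReal ((lam - w) ^ r) ∂H) := by
  simp only [← lintegral_indicator measurableSet_Ioi]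
  exact (measurable_fractional_kernel r).lintegral_prod_right'

theorem lintegral_beta_Ioo {p q a b : ℝ} (hp : 0 < p) (hq : 0 < q) (hab : a < b) :
    ∫⁻ x in Set.Ioo a b, ENNReal.ofReal ((x - a) ^ (p - 1)) * ENNReal.ofReal ((b - x) ^ (q - 1)) =
      ENNReal.ofReal (beta p q) * ENNReal.ofReal ((b - a) ^ (p + q - 1)) := by
  have hd : 0 < b - a := by linarith
  have hB := beta_pos hp hq
  have himg : (fun x : ℝ => a + (b - a) * x) '' Set.Ioo 0 1 = Set.Ioo a b := by
    ext y
    simp only [Set.mem_image, Set.mem_Ioo]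
    constructor
    · rintro ⟨x, ⟨h0, h1⟩, rfl⟩
      constructor <;> nlinarith
    · rintro ⟨h0, h1⟩
      refine ⟨(y - a) / (b - a), ⟨div_pos (by linarith) hd, (div_lt_one hd).2 (by linarith)⟩, ?_⟩
      field_simp
      ring
  rw [← himg, lintegral_image_eq_lintegral_abs_deriv_mul (f' := fun _ => b - a) measurableSet_Ioo
    (fun x _ => by
      have : HasDerivAt (fun x : ℝ => a + (b - a) * x) (b - a) x := by
        simpa using ((hasDerivAt_id x).const_mul (b - a)).const_add a
      exact this.hasDerivWithinAt)
    (fun x _ y _ h => by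
      have : (b - a) * x = (b - a) * y := by simpa using h
      exact mul_left_cancel₀ hd.ne' this)]
  have key : ∀ x ∈ Set.Ioo (0 : ℝ) 1, ENNReal.ofReal |b - a| *
      (ENNReal.ofReal ((a + (b - a) * x - a) ^ (p - 1)) *
        ENNReal.ofReal ((b - (a + (b - a) * x)) ^ (q - 1))) =
      ENNReal.ofReal (beta p q) * ENNReal.ofReal ((b - a) ^ (p + q - 1)) * betaPDF p q x := by
    rintro x ⟨h0, h1⟩
    have h1' : 0 < 1 - x := by linarith
    rw [betaPDF_of_pos_lt_one h0 h1, abs_of_pos hd, ← ENNReal.ofReal_mul (by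
        rw [add_sub_cancel_left]; positivity),
      ← ENNReal.ofReal_mul hd.le, ← ENNReal.ofReal_mul hB.le, ← ENNReal.ofReal_mul (by positivity)]
    congr 1
    rw [add_sub_cancel_left, show b - (a + (b - a) * x) = (b - a) * (1 - x) by ring,
      Real.mul_rpow hd.le h0.le, Real.mul_rpow hd.le h1'.le,
      show p + q - 1 = 1 + (p - 1) + (q - 1) by ring, Real.rpow_add hd, Real.rpow_add hd,
      Real.rpow_one]
    field_simp
  rw [setLIntegral_congr_fun measurableSet_Ioo key, lintegral_const_mul' _ _ (by finiteness)]
  have : ∫⁻ x in Set.Ioo (0 : ℝ) 1, betaPDF p q x = 1 := by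
    rw [← lintegral_betaPDF_eq_one hp hq, ← lintegral_indicator measurableSet_Ioo]
    congr 1
    ext x
    by_cases hx : x ∈ Set.Ioo (0 : ℝ) 1
    · rw [Set.indicator_of_mem hx]
    · rw [Set.indicator_of_notMem hx, betaPDF_eq, if_neg (by simpa using hx), ENNReal.ofReal_zero]
  rw [this, mul_one]

/-- Lowering the order of a fractional integral. -/
theorem exists_measure_fractional_lintegral_eq {k l : ℝ} (hk : 0 < k) (hkl : k ≤ l)
    (H : Measure ℝ) [SFinite H] : ∃ H' : Measure ℝ, SFinite H' ∧ ∀ w,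
      ∫⁻ lam in Set.Ioi w, ENNReal.ofReal ((lam - w) ^ (l - 1)) ∂H =
        ∫⁻ lam in Set.Ioi w, ENNReal.ofReal ((lam - w) ^ (k - 1)) ∂H' := by
  rcases hkl.eq_or_lt with rfl | hlt
  · exact ⟨H, inferInstance, fun w => rfl⟩
  have hq : 0 < l - k := by linarith
  set B := ENNReal.ofReal (beta k (l - k)) with hBdef
  have hB0 : B ≠ 0 := (ENNReal.ofReal_pos.2 (beta_pos hk hq)).ne'
  have hBt : B ≠ ⊤ := ENNReal.ofReal_ne_top
  set D : ℝ → ENNReal := fun m =>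
    B⁻¹ * ∫⁻ lam in Set.Ioi m, ENNReal.ofReal ((lam - m) ^ (l - k - 1)) ∂H with hD
  have hDm : Measurable D := (measurable_fractional_lintegral H _).const_mul _
  refine ⟨volume.withDensity D, inferInstance, fun w => ?_⟩
  rw [restrict_withDensity measurableSet_Ioi,
    lintegral_withDensity_eq_lintegral_mul _ hDm (by fun_prop)]
  simp only [Pi.mul_apply, hD]
  symm
  calc ∫⁻ m in Set.Ioi w, B⁻¹ * (∫⁻ lam in Set.Ioi m,
          ENNReal.ofReal ((lam - m) ^ (l - k - 1)) ∂H) * ENNReal.ofReal ((m - w) ^ (k - 1))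
      = ∫⁻ m in Set.Ioi w, ∫⁻ lam, B⁻¹ * ((Set.Ioi m).indicator
          (fun lam => ENNReal.ofReal ((lam - m) ^ (l - k - 1))) lam *
            ENNReal.ofReal ((m - w) ^ (k - 1))) ∂H := by
        refine lintegral_congr fun m => ?_
        rw [lintegral_const_mul' _ _ (ENNReal.inv_ne_top.2 hB0),
          lintegral_mul_const' _ _ ENNReal.ofReal_ne_top, lintegral_indicator measurableSet_Ioi,
          mul_assoc]
    _ = ∫⁻ lam, (∫⁻ m in Set.Ioi w, B⁻¹ * ((Set.Ioi m).indicator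
          (fun lam => ENNReal.ofReal ((lam - m) ^ (l - k - 1))) lam *
            ENNReal.ofReal ((m - w) ^ (k - 1)))) ∂H := by
        refine lintegral_lintegral_swap (Measurable.aemeasurable ?_)
        exact ((measurable_fractional_kernel _).mul (by fun_prop)).const_mul _
    _ = ∫⁻ lam, (Set.Ioi w).indicator
          (fun lam => ENNReal.ofReal ((lam - w) ^ (l - 1))) lam ∂H := by
        refine lintegral_congr fun lam => ?_
        rw [lintegral_const_mul' _ _ (ENNReal.inv_ne_top.2 hB0)]
        have e : ∀ m ∈ Set.Ioi w, (Set.Ioi m).indicator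
            (fun lam => ENNReal.ofReal ((lam - m) ^ (l - k - 1))) lam *
            ENNReal.ofReal ((m - w) ^ (k - 1)) = (Set.Ioo w lam).indicator
            (fun m => ENNReal.ofReal ((m - w) ^ (k - 1)) *
              ENNReal.ofReal ((lam - m) ^ (l - k - 1))) m := by
          intro m hm
          have hm' : w < m := hm
          by_cases h : m < lam
          · simp [h, hm', mul_comm]
          · simp [h]
        rw [setLIntegral_congr_fun measurableSet_Ioi e, lintegral_indicator measurableSet_Ioo,
          Measure.restrict_restrict measurableSet_Ioo,
          Set.inter_eq_left.2 Set.Ioo_subset_Ioi_self]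
        by_cases h : w < lam
        · rw [lintegral_beta_Ioo hk hq h, Set.indicator_of_mem (Set.mem_Ioi.2 h), ← hBdef,
            ← mul_assoc, ENNReal.inv_mul_cancel hB0 hBt, one_mul,
            show k + (l - k) - 1 = l - 1 by ring]
        · rw [Set.Ioo_eq_empty h, Set.indicator_of_notMem (by simpa using h)]
          simp
    _ = _ := lintegral_indicator measurableSet_Ioi _

theorem sFinite_of_lintegral_ne_top {α : Type*} [MeasurableSpace α] {m : Measure α}
    {ρ : α → ENNReal} (hρ : Measurable ρ) (h0 : ∀ᵐ x ∂m, ρ x ≠ 0) (ht : ∀ᵐ x ∂m, ρ x ≠ ⊤)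
    (hint : ∫⁻ x, ρ x ∂m ≠ ⊤) : SFinite m := by
  have : IsFiniteMeasure (m.withDensity ρ) := isFiniteMeasure_withDensity hint
  rw [← withDensity_inv_same hρ h0 ht]
  infer_instance

theorem lintegral_exp_comp_eq (s : Set ℝ) (hs : MeasurableSet s) (φ : ℝ → ENNReal) :
    ∫⁻ t in Real.log ⁻¹' s ∩ Set.Ioi 0, φ t =
      ∫⁻ t in s, ENNReal.ofReal (exp t) * φ (exp t) := by
  have h : Real.log ⁻¹' s ∩ Set.Ioi 0 = Real.exp '' s := by
    ext x
    constructor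
    · rintro ⟨h1, h2⟩
      exact ⟨log x, h1, exp_log h2⟩
    · rintro ⟨t, ht, rfl⟩
      exact ⟨by simpa using ht, exp_pos t⟩
  rw [h, lintegral_image_eq_lintegral_abs_deriv_mul hs
    (fun x _ => (Real.hasDerivAt_exp x).hasDerivWithinAt) Real.exp_injective.injOn]
  simp_rw [abs_exp]

theorem map_log_withDensity (φ : ℝ → ENNReal) :
    Measure.map Real.log ((volume.restrict (Set.Ioi (0:ℝ))).withDensity φ) =
      volume.withDensity fun t => ENNReal.ofReal (exp t) * φ (exp t) := by
  ext s hs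
  rw [Measure.map_apply Real.measurable_log hs, withDensity_apply _ hs,
    withDensity_apply _ (Real.measurable_log hs), Measure.restrict_restrict (Real.measurable_log hs),
    lintegral_exp_comp_eq s hs]

theorem IsHMDensity.exists_sFinite {l : ℝ} {f : ℝ → ℝ} (hf : IsHMDensity l f) (c : ℝ) :
    ∃ H : Measure ℝ, SFinite H ∧ ∀ x,
      ENNReal.ofReal (exp x) * ENNReal.ofReal (f (exp x)) *
        (ENNReal.ofReal (exp (c - x)) * ENNReal.ofReal (f (exp (c - x)))) =
      ∫⁻ lam in Set.Ioi (2 * cosh (x - c / 2)),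
        ENNReal.ofReal ((lam - 2 * cosh (x - c / 2)) ^ (l - 1)) ∂H := by
  obtain ⟨H, hH⟩ := hf.2.2 (exp (c / 2)) (exp_pos _)
  have hfin : SFinite (H.restrict (Set.Ioi 2)) := by
    refine sFinite_of_lintegral_ne_top (ρ := fun lam => ENNReal.ofReal ((lam - 2) ^ (l - 1)))
      (by fun_prop) ?_ (by simp) ?_
    · refine (ae_restrict_mem measurableSet_Ioi).mono fun lam hlam => ?_
      have : 0 < lam - 2 := sub_pos.2 hlam
      simpa using rpow_pos_of_pos this _
    · have h1 := hH 1 one_pos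
      norm_num at h1
      rw [← h1]
      exact ENNReal.ofReal_ne_top
  refine ⟨ENNReal.ofReal (exp c) • H.restrict (Set.Ioi 2), inferInstance, fun x => ?_⟩
  have hw : exp (x - c / 2) + (exp (x - c / 2))⁻¹ = 2 * cosh (x - c / 2) := by
    rw [cosh_eq, ← exp_neg]
    ring
  have h := hH (exp (x - c / 2)) (exp_pos _)
  rw [hw, ← exp_add, ← exp_sub, show c / 2 + (x - c / 2) = x by ring,
    show c / 2 - (x - c / 2) = c - x by ring] at h
  rw [Measure.restrict_smul, lintegral_smul_measure,
    Measure.restrict_restrict measurableSet_Ioi, Set.inter_eq_left.2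
      (Set.Ioi_subset_Ioi (by linarith [one_le_cosh (x - c / 2)])), ← h,
    ENNReal.ofReal_mul (hf.1 _), smul_eq_mul, show c = x + (c - x) by ring, exp_add,
    ENNReal.ofReal_mul (exp_pos _).le, show x + (c - x) - x = c - x by ring]
  ring

theorem IsHMDensity.exists_logDensity {k l : ℝ} (hk : 0 < k) (hkl : k ≤ l) {f : ℝ → ℝ}
    (hf : IsHMDensity l f) :
    ∃ g : ℝ → ENNReal, Measurable g ∧ (∀ t, g t ≠ ⊤) ∧ ∫⁻ t, g t = 1 ∧
      (∀ a, ∃ H : Measure ℝ, SFinite H ∧ ∀ᵐ b, g (a + b) * g (a - b) =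
        ∫⁻ lam in Set.Ioi (2 * cosh b), ENNReal.ofReal ((lam - 2 * cosh b) ^ (k - 1)) ∂H) ∧
      Measure.map Real.log ((volume.restrict (Set.Ioi (0:ℝ))).withDensity
        (fun x => ENNReal.ofReal (f x))) = volume.withDensity g := by
  set F : ℝ → ENNReal := fun t => ENNReal.ofReal (exp t) * ENNReal.ofReal (f (exp t)) with hFdef
  have htop : ∀ t, F t ≠ ⊤ := fun t => ENNReal.mul_ne_top ENNReal.ofReal_ne_top ENNReal.ofReal_ne_top
  have hF : ∫⁻ t, F t = 1 := by
    have h := lintegral_exp_comp_eq Set.univ MeasurableSet.univ fun x => ENNReal.ofReal (f x)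
    rw [Set.preimage_univ, Set.univ_inter, hf.2.1, Measure.restrict_univ] at h
    exact h.symm
  have hmeas : ∀ c, Measurable fun x => F x * F (c - x) := by
    intro c
    obtain ⟨H, hH, hHc⟩ := hf.exists_sFinite c
    simp_rw [hFdef, hHc]
    exact (measurable_fractional_lintegral H (l - 1)).comp
      (by fun_prop : Measurable fun x => 2 * cosh (x - c / 2))
  obtain ⟨g, hg, hgF, hg1, C, hC⟩ := exists_measurable_mul_reflect_eq htop hF hmeas
  refine ⟨g, hg, fun t => ne_top_of_le_ne_top (htop t) (hgF t), hg1, fun a => ?_, ?_⟩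
  · obtain ⟨H, hH, hHc⟩ := hf.exists_sFinite (2 * a)
    obtain ⟨H', hH', hHH'⟩ := exists_measure_fractional_lintegral_eq hk hkl H
    refine ⟨H'.withDensity fun _ => C, inferInstance, ?_⟩
    have h := (measurePreserving_add_left volume a).quasiMeasurePreserving.ae (hC (2 * a))
    filter_upwards [h] with b hb
    rw [show 2 * a - (a + b) = a - b by ring] at hb
    have h2 := hHc (a + b)
    rw [show 2 * a - (a + b) = a - b by ring, show a + b - 2 * a / 2 = b by ring, hHH'] at h2
    rw [hb, withDensity_const, Measure.restrict_smul, lintegral_smul_measure, ← h2, smul_eq_mul]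
  · rw [map_log_withDensity]
    have hgu : (volume.withDensity g) Set.univ = 1 := by simpa using hg1
    have hFu : (volume.withDensity F) Set.univ = 1 := by simpa using hF
    have : IsFiniteMeasure (volume.withDensity F) := ⟨by rw [hFu]; simp⟩
    have : IsFiniteMeasure (volume.withDensity g) := ⟨by rw [hgu]; simp⟩
    refine (Measure.eq_of_le_of_measure_univ_eq ?_ (hgu.trans hFu.symm)).symm
    exact withDensity_mono (ae_of_all _ hgF)

theorem integral_exp_neg_mul_gammaMeas {k s : ℝ} (hk : 0 < k) (hs : 0 ≤ s) :
    ∫ y, exp (-s * y) ∂(gammaMeas k 1) = (1 + s) ^ (-k) := by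
  rw [gammaMeas, integral_withDensity_eq_integral_toReal_smul (by fun_prop) (by simp)]
  have h1 : 0 < 1 + s := by linarith
  have hG := Real.Gamma_pos_of_pos hk
  have h2 := Real.integral_rpow_mul_exp_neg_mul_Ioi hk h1
  rw [rpow_neg h1.le, ← one_div, one_div, ← inv_rpow h1.le, ← one_div,
    ← mul_div_cancel_right₀ ((1 / (1 + s)) ^ k) hG.ne', ← h2, ← integral_div]
  refine setIntegral_congr_fun measurableSet_Ioi fun x (hx : 0 < x) => ?_
  have h3 : 0 ≤ 1 ^ k / Real.Gamma k * x ^ (k - 1) * exp (-(1 * x)) := by positivity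
  rw [ENNReal.toReal_ofReal h3, smul_eq_mul, one_rpow, show -((1 + s) * x) = -(1 * x) + -s * x by ring,
    exp_add]
  ring

theorem gammaMeas_ae_pos (k r : ℝ) : ∀ᵐ y ∂(gammaMeas k r), 0 < y :=
  withDensity_absolutelyContinuous _ _ (ae_restrict_mem measurableSet_Ioi)

theorem integral_exp_neg_mul_map_mul {Ω : Type*} [MeasurableSpace Ω] {P : Measure Ω}
    [IsProbabilityMeasure P] {k : ℝ} (hk : 0 < k) {Y X : Ω → ℝ} (hY : Measurable Y)
    (hX : Measurable X) (hYd : Measure.map Y P = gammaMeas k 1) (hXpos : ∀ᵐ ω ∂P, 0 < X ω)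
    (hindep : IndepFun Y X P) {s : ℝ} (hs : 0 ≤ s) :
    ∫ z, exp (-s * z) ∂(Measure.map (fun ω => Y ω * X ω) P) =
      ∫ t, (1 + s * exp t) ^ (-k) ∂(Measure.map Real.log (Measure.map X P)) := by
  have hXpos' : ∀ᵐ x ∂(Measure.map X P), 0 < x :=
    (ae_map_iff hX.aemeasurable measurableSet_Ioi).2 hXpos
  have hYpos : ∀ᵐ y ∂(Measure.map Y P), 0 < y := hYd ▸ gammaMeas_ae_pos k 1
  have : IsProbabilityMeasure (Measure.map X P) := Measure.isProbabilityMeasure_map hX.aemeasurable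
  have : IsProbabilityMeasure (Measure.map Y P) := Measure.isProbabilityMeasure_map hY.aemeasurable
  have hprod := hindep.map_prod_eq_prod_map_map hY.aemeasurable hX.aemeasurable
  have hmap : Measure.map (fun ω => Y ω * X ω) P =
      Measure.map (fun p : ℝ × ℝ => p.1 * p.2) ((Measure.map Y P).prod (Measure.map X P)) := by
    rw [← hprod, Measure.map_map (by fun_prop) (by fun_prop)]
    rfl
  have hint : Integrable (fun p : ℝ × ℝ => exp (-s * (p.1 * p.2)))
      ((Measure.map Y P).prod (Measure.map X P)) := by
    refine Integrable.of_bound (C := 1) (by fun_prop) ?_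
    have h1 : ∀ᵐ p ∂((Measure.map Y P).prod (Measure.map X P)), 0 < p.1 :=
      Measure.quasiMeasurePreserving_fst.ae hYpos
    have h2 : ∀ᵐ p ∂((Measure.map Y P).prod (Measure.map X P)), 0 < p.2 :=
      Measure.quasiMeasurePreserving_snd.ae hXpos'
    filter_upwards [h1, h2] with p hp1 hp2
    rw [norm_of_nonneg (exp_pos _).le, exp_le_one_iff, neg_mul, neg_nonpos]
    positivity
  rw [hmap, integral_map (by fun_prop) (by fun_prop), integral_prod_symm _ hint,
    integral_map Real.measurable_log.aemeasurable (by
      refine Measurable.aestronglyMeasurable ?_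
      fun_prop)]
  refine integral_congr_ae ?_
  filter_upwards [hXpos'] with x hx
  rw [exp_log hx, hYd, ← integral_exp_neg_mul_gammaMeas hk (by positivity)]
  congr 1 with y
  ring_nf

theorem gamma_times_HM_is_GGC
    {Ω : Type*} [MeasurableSpace Ω] (P : Measure Ω) [IsProbabilityMeasure P]
    (k l : ℝ) (hk : 0 < k) (hkl : k ≤ l)
    (Y X : Ω → ℝ) (hY : Measurable Y) (hX : Measurable X)
    (hYd : Measure.map Y P = gammaMeas k 1)
    (f : ℝ → ℝ) (hf : IsHMDensity l f) (hXd : HasDensityOn P X f)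
    (hXpos : ∀ᵐ ω ∂P, 0 < X ω)
    (hindep : IndepFun Y X P) :
    IsGGC (Measure.map (fun ω => Y ω * X ω) P) := by
  obtain ⟨g, hg, hgtop, hg1, hH, hlaw⟩ := hf.exists_logDensity hk hkl
  obtain ⟨a, U, ha, hU0, hU1, hU2, hU3, hU⟩ := exists_thorin_of_logDensity hk hg hgtop hg1 hH
  refine ⟨Measure.isProbabilityMeasure_map (hY.mul hX).aemeasurable, ?_, a, U, ha, hU0, hU1, hU2,
    hU3, fun s hs => ?_⟩
  · have hYpos : ∀ᵐ ω ∂P, 0 < Y ω :=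
      (ae_map_iff hY.aemeasurable measurableSet_Ioi).1 (hYd ▸ gammaMeas_ae_pos k 1)
    rw [Measure.map_apply (by fun_prop) measurableSet_Iio]
    have h : ∀ᵐ ω ∂P, ¬ Y ω * X ω < 0 := by
      filter_upwards [hYpos, hXpos] with ω h1 h2
      exact not_lt.2 (by positivity)
    simp only [ae_iff, not_not] at h
    exact h
  · rw [integral_exp_neg_mul_map_mul hk hY hX hYd hXpos hindep hs, show Measure.map X P = _ from hXd,
      hlaw, hU s hs]
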